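/- arXiv:1710.02440 — 2 statements merged into one kernel-verified Lean document; each statement's English description precedes it below -/
import Mathlib

section
/- Let 1 ≤ t < k and n ≥ 2k + 3t/(1−t/k), i.e., n ≥ 2k + 3tk/(k−t). Then every intersecting family F of k-element subsets of [n] satisfies δ_t(F) ≤ C(n−t−1, k−t−1). -/
open Finset

def IntersectingFam (F : Finset (Finset ℕ)) : Prop :=
  ∀ A ∈ F, ∀ B ∈ F, (A ∩ B).Nonempty

def CrossIntersecting (𝒜 ℬ : Finset (Finset ℕ)) : Prop :=
  ∀ A ∈ 𝒜, ∀ B ∈ ℬ, (A ∩ B).Nonempty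

/-- The degree of an element `i`: the number of sets of `F` containing `i`. -/
def famDeg (F : Finset (Finset ℕ)) (i : ℕ) : ℕ := (F.filter (fun A => i ∈ A)).card

/-- The maximal degree `Δ(F)` over the ground set `[n]`. -/
def maxDeg (n : ℕ) (F : Finset (Finset ℕ)) : ℕ := (Finset.Icc 1 n).sup (famDeg F)

/-- The diversity `γ(F) = |F| − Δ(F)`. -/
def diversity (n : ℕ) (F : Finset (Finset ℕ)) : ℕ := F.card - maxDeg n F

/-- The degree of a subset `S`: the number of sets of `F` containing `S`. -/
def tDeg (F : Finset (Finset ℕ)) (S : Finset ℕ) : ℕ := (F.filter (fun A => S ⊆ A)).card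

/-- Lexicographic order: `A ⪯ B` iff `A ⊇ B` or `min (A \ B) < min (B \ A)`. -/
def lexLE (A B : Finset ℕ) : Prop := B ⊆ A ∨ (A \ B).min < (B \ A).min

instance : DecidableRel lexLE := fun A B => by unfold lexLE; exact inferInstance

def lexLT (A B : Finset ℕ) : Prop := lexLE A B ∧ A ≠ B

/-- Lex family with characteristic set `X` on ground set `[2,n]`:
`L(X,a) = {A ⊆ [2,n] : |A| = a, A ⪯ X ∩ [2,n]}`. -/
def lexFam (n a : ℕ) (X : Finset ℕ) : Finset (Finset ℕ) :=
  ((Finset.Icc 2 n).powersetCard a).filter (fun A => lexLE A (X ∩ Finset.Icc 2 n))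

/-- Lex family with characteristic set `X` on ground set `[n]`:
`L(X,c) = {A ⊆ [n] : |A| = c, A ⪯ X}`. -/
def lexFam1 (n c : ℕ) (X : Finset ℕ) : Finset (Finset ℕ) :=
  ((Finset.Icc 1 n).powersetCard c).filter (fun A => lexLE A X)

/-- Resistant pairs for uniformity `k` on ground set `[n]`. -/
def ResistantPair (n k : ℕ) (S T : Finset ℕ) : Prop :=
  (S = ({1, 4} : Finset ℕ) ∧ T = ({2, 3, 4} : Finset ℕ)) ∨
  (1 ∈ S ∧ S ⊆ Finset.Icc 1 n ∧ T ⊆ Finset.Icc 2 n ∧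
    ∃ j : ℕ, T.max = (j : WithTop ℕ) ∧ S ∩ T = {j} ∧ S ∪ T = Finset.Icc 1 j ∧
      S.card ≤ k ∧ T.card ≤ k ∧
      ∀ i : ℕ, 4 ≤ i → i ≤ j → (Finset.Icc 1 i ∩ S).card < (Finset.Icc 1 i \ S).card)

/-- `(a,b)`-resistant pairs on ground set `[n]`. -/
def ABResistantPair (n a b : ℕ) (S T : Finset ℕ) : Prop :=
  (T = Finset.Icc 1 (b - a + 2) ∧ S = ({1, b - a + 2} : Finset ℕ)) ∨
  (S ⊆ Finset.Icc 1 n ∧ T ⊆ Finset.Icc 1 n ∧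
    ∃ j : ℕ, T.max = (j : WithTop ℕ) ∧ S ∩ T = {j} ∧ S ∪ T = Finset.Icc 1 j ∧
      S.card ≤ a ∧ T.card ≤ b ∧
      ∀ i : ℕ, b - a + 2 ≤ i → i ≤ j →
        ((Finset.Icc 1 i ∩ S).card : ℤ) - (a : ℤ) < ((Finset.Icc 1 i \ S).card : ℤ) - (b : ℤ))

/-- Resistant numbers: `γ` is resistant if in its `(n−k−1)`-cascade form
`γ = Σ_{i=1}^s C(n−b_i, n−k−i)` (with `1 ≤ b_1 < … < b_s`) one has `|S_γ| ≤ k`,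
`s ≤ k−1` and `b_i > 2i+2` for each `i`; in addition `C(n−4,k−3)` is resistant. -/
def IsResistantNum (n k γ : ℕ) : Prop :=
  γ = Nat.choose (n - 4) (k - 3) ∨
  ∃ (s : ℕ) (b : ℕ → ℕ), 1 ≤ s ∧ 1 ≤ b 1 ∧
    (∀ i j, 1 ≤ i → i < j → j ≤ s → b i < b j) ∧
    γ = ∑ i ∈ Finset.Icc 1 s, Nat.choose (n - b i) (n - k - i) ∧
    s ≤ k - 1 ∧
    (insert (b s) (Finset.Icc 2 (b s) \ (Finset.Icc 1 s).image b)).card ≤ k ∧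
    (∀ i, 1 ≤ i → i ≤ s → b i > 2 * i + 2)

/-- The family `J_i`. -/
def Jfam (n k i : ℕ) : Finset (Finset ℕ) :=
  {Finset.Icc 2 (k+1), Finset.Icc (i+1) (k+i)} ∪
    ((Finset.Icc 1 n).powersetCard k).filter
      (fun F => 1 ∈ F ∧ (F ∩ Finset.Icc 2 (k+1)).Nonempty ∧ (F ∩ Finset.Icc (i+1) (k+i)).Nonempty)

/-- Two families are isomorphic if one is obtained from the other by a permutation
of the ground set `[n]`. -/
def IsomorphicFam (n : ℕ) (F G : Finset (Finset ℕ)) : Prop :=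
  ∃ σ : Equiv.Perm ℕ, (Finset.Icc 1 n).image σ = Finset.Icc 1 n ∧
    F.image (fun A => A.image σ) = G

/-- `F` is isomorphic to a subfamily of `G`. -/
def IsoSubfamily (n : ℕ) (F G : Finset (Finset ℕ)) : Prop :=
  ∃ σ : Equiv.Perm ℕ, (Finset.Icc 1 n).image σ = Finset.Icc 1 n ∧
    F.image (fun A => A.image σ) ⊆ G

/-- `L` is an initial segment of the lex order on `k`-subsets of `[2,n]`. -/
def IsInitialSeg (n k : ℕ) (L : Finset (Finset ℕ)) : Prop :=
  L ⊆ (Finset.Icc 2 n).powersetCard k ∧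
  ∀ A ∈ L, ∀ B ∈ (Finset.Icc 2 n).powersetCard k, lexLE B A → B ∈ L

/-- The maximal intersecting family `F_l` whose sets avoiding `1` are exactly `L`. -/
def maxFam (n k : ℕ) (L : Finset (Finset ℕ)) : Finset (Finset ℕ) :=
  L ∪ ((Finset.Icc 1 n).powersetCard k).filter
    (fun A => 1 ∈ A ∧ ∀ B ∈ L, (A ∩ B).Nonempty)

/-- The sets `T` allowed in the recursive definition of a `T_l`-neutral pair:
`T_l` is allowed, and whenever `T'` is allowed so is `T' ∪ {2|T'|}`. -/
inductive NeutralSet (T0 : Finset ℕ) : Finset ℕ → Prop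
  | base : NeutralSet T0 T0
  | step (T' : Finset ℕ) : NeutralSet T0 T' → NeutralSet T0 (insert (2 * T'.card) T')

/-- The family `A_0(n,k,s)`. -/
def A0fam (n k s : ℕ) : Finset (Finset ℕ) :=
  ((Finset.Icc 1 n).powersetCard k).filter (fun A => (A ∩ Finset.Icc 1 s).Nonempty)

section Shadow
variable {α : Type*} [DecidableEq α]

/-- The `ℓ`-element sets contained in a member of `𝒜`. -/
def lowerShadow (ℓ : ℕ) (𝒜 : Finset (Finset α)) : Finset (Finset α) :=
  𝒜.biUnion (powersetCard ℓ)

lemma mem_lowerShadow {ℓ : ℕ} {𝒜 : Finset (Finset α)} {S : Finset α} :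
    S ∈ lowerShadow ℓ 𝒜 ↔ #S = ℓ ∧ ∃ A ∈ 𝒜, S ⊆ A := by
  simp only [lowerShadow, mem_biUnion, mem_powersetCard]
  tauto

lemma lowerShadow_mono {ℓ : ℕ} {𝒜 ℬ : Finset (Finset α)} (h : 𝒜 ⊆ ℬ) :
    lowerShadow ℓ 𝒜 ⊆ lowerShadow ℓ ℬ := biUnion_subset_biUnion_of_subset_left _ h

/-- The number of `r`-sets between a fixed `ℓ`-set and `Y`. -/
lemma card_filter_superset_powersetCard {Y S : Finset α} (hS : S ⊆ Y) {r : ℕ} (hr : #S ≤ r) :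
    #{A ∈ powersetCard r Y | S ⊆ A} = (#Y - #S).choose (r - #S) := by
  rw [← card_sdiff_of_subset hS, ← card_powersetCard]
  symm
  apply card_bij (fun A _ => A ∪ S)
  · intro A hA
    simp only [mem_powersetCard, mem_filter] at hA ⊢
    have hd : Disjoint A S := (subset_sdiff.1 hA.1).2
    refine ⟨⟨union_subset (hA.1.trans sdiff_subset) hS, ?_⟩, subset_union_right⟩
    rw [card_union_of_disjoint hd]; omega
  · intro A hA B hB h
    simp only [mem_powersetCard] at hA hB
    have hd : Disjoint A S := (subset_sdiff.1 hA.1).2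
    have hd' : Disjoint B S := (subset_sdiff.1 hB.1).2
    rw [← union_sdiff_cancel_right hd, h, union_sdiff_cancel_right hd']
  · intro B hB
    simp only [mem_powersetCard, mem_filter] at hB ⊢
    refine ⟨B \ S, ⟨sdiff_subset_sdiff hB.1.1 le_rfl, ?_⟩, sdiff_union_of_subset hB.2⟩
    rw [card_sdiff_of_subset hB.2]; omega

/-- The local LYM inequality for iterated shadows, relative to a ground set `Y`. -/
lemma card_mul_choose_le_card_lowerShadow_mul {Y : Finset α} {𝒜 : Finset (Finset α)} {r ℓ : ℕ}
    (h𝒜 : 𝒜 ⊆ powersetCard r Y) (hℓ : ℓ ≤ r) :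
    #𝒜 * (#Y).choose ℓ ≤ #(lowerShadow ℓ 𝒜) * (#Y).choose r := by
  have key : #𝒜 * r.choose ℓ ≤ #(lowerShadow ℓ 𝒜) * (#Y - ℓ).choose (r - ℓ) := by
    refine card_mul_le_card_mul (fun A S => S ⊆ A) (fun A hA => ?_) (fun S hS => ?_)
    · rw [← (mem_powersetCard.1 (h𝒜 hA)).2, ← card_powersetCard]
      refine card_le_card fun S hS => ?_
      obtain ⟨h1, h2⟩ := mem_powersetCard.1 hS
      exact mem_filter.2 ⟨mem_lowerShadow.2 ⟨h2, A, hA, h1⟩, h1⟩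
    · obtain ⟨rfl, A, hA, hSA⟩ := mem_lowerShadow.1 hS
      rw [← card_filter_superset_powersetCard (hSA.trans (mem_powersetCard.1 (h𝒜 hA)).1) hℓ]
      refine card_le_card fun B hB => ?_
      obtain ⟨h1, h2⟩ := mem_filter.1 hB
      exact mem_filter.2 ⟨h𝒜 h1, h2⟩
  have hmul := Nat.choose_mul (n := #Y) hℓ
  refine Nat.le_of_mul_le_mul_right ?_ (Nat.choose_pos hℓ)
  calc #𝒜 * (#Y).choose ℓ * r.choose ℓ = #𝒜 * r.choose ℓ * (#Y).choose ℓ := by ring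
    _ ≤ #(lowerShadow ℓ 𝒜) * (#Y - ℓ).choose (r - ℓ) * (#Y).choose ℓ := by gcongr
    _ = #(lowerShadow ℓ 𝒜) * ((#Y).choose r * r.choose ℓ) := by rw [hmul]; ring
    _ = _ := by ring

lemma shadow_iterate_eq_lowerShadow {𝒜 : Finset (Finset α)} {r ℓ : ℕ}
    (h𝒜 : (𝒜 : Set (Finset α)).Sized r) (hℓ : ℓ ≤ r) :
    (Finset.shadow)^[r - ℓ] 𝒜 = lowerShadow ℓ 𝒜 := by
  ext S
  rw [mem_shadow_iterate_iff_exists_sdiff, mem_lowerShadow]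
  constructor
  · rintro ⟨A, hA, hSA, hc⟩
    have := h𝒜 hA
    have h2 := card_le_card hSA
    rw [card_sdiff_of_subset hSA] at hc
    exact ⟨by omega, A, hA, hSA⟩
  · rintro ⟨hS, A, hA, hSA⟩
    refine ⟨A, hA, hSA, ?_⟩
    rw [card_sdiff_of_subset hSA, h𝒜 hA, hS]

end Shadow

section Fin
open Colex

lemma exists_isInitSeg_card {α : Type*} [LinearOrder α] [Fintype α] {r x : ℕ}
    (hx : x ≤ (Fintype.card α).choose r) :
    ∃ 𝒞 : Finset (Finset α), IsInitSeg 𝒞 r ∧ #𝒞 = x := by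
  induction x with
  | zero => exact ⟨∅, isInitSeg_empty, rfl⟩
  | succ x ih =>
    obtain ⟨𝒞, h𝒞, hc⟩ := ih (by omega)
    have hne : (powersetCard r univ \ 𝒞).Nonempty := by
      rw [← card_pos]
      have := le_card_sdiff 𝒞 (powersetCard r (univ : Finset α))
      rw [card_powersetCard, card_univ] at this
      omega
    obtain ⟨s, hs, hmin⟩ := exists_min_image _ toColex hne
    rw [mem_sdiff, mem_powersetCard] at hs
    refine ⟨insert s 𝒞, ⟨?_, ?_⟩, ?_⟩
    · intro t ht
      rcases mem_insert.1 ht with rfl | ht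
      · exact hs.1.2
      · exact h𝒞.1 ht
    · rintro a b ha ⟨hab, hb⟩
      rcases mem_insert.1 ha with rfl | ha
      · by_contra hbn
        have := hmin b (by simp_all)
        exact absurd hab (not_lt.2 this)
      · exact mem_insert_of_mem (h𝒞.2 ha ⟨hab, hb⟩)
    · rw [card_insert_of_notMem hs.2, hc]

/-- The first `m` elements of `Fin n`. -/
def finPrefix (n m : ℕ) : Finset (Fin n) := {i | (i : ℕ) < m}

lemma card_finPrefix {n m : ℕ} (h : m ≤ n) : #(finPrefix n m) = m := by
  simp [finPrefix, Fin.card_filter_val_lt, h]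

lemma isInitSeg_powersetCard_finPrefix (n m r : ℕ) :
    IsInitSeg (powersetCard r (finPrefix n m)) r := by
  refine ⟨Set.sized_powersetCard _ _, ?_⟩
  rintro A B hA ⟨hlt, hB⟩
  rw [mem_powersetCard] at hA ⊢
  refine ⟨fun t ht => ?_, hB⟩
  simp only [finPrefix, mem_filter, mem_univ, true_and]
  have := (toColex_image_lt_toColex_image Fin.val_strictMono).2 hlt
  refine forall_lt_mono this.le ?_ t (mem_image_of_mem _ ht)
  intro b hb
  obtain ⟨a, ha, rfl⟩ := mem_image.1 hb
  simpa [finPrefix] using hA.1 ha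

lemma exists_isInitSeg_le_lowerShadow {n r ℓ : ℕ} {𝒜 : Finset (Finset (Fin n))}
    (h𝒜 : (𝒜 : Set (Finset (Fin n))).Sized r) (hℓ : ℓ ≤ r) :
    ∃ 𝒞 : Finset (Finset (Fin n)), IsInitSeg 𝒞 r ∧ #𝒞 = #𝒜 ∧
      #(lowerShadow ℓ 𝒞) ≤ #(lowerShadow ℓ 𝒜) := by
  obtain ⟨𝒞, h𝒞, hc⟩ := exists_isInitSeg_card (α := Fin n) (r := r) (x := #𝒜) h𝒜.card_le
  refine ⟨𝒞, h𝒞, hc, ?_⟩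
  rw [← shadow_iterate_eq_lowerShadow h𝒜 hℓ, ← shadow_iterate_eq_lowerShadow h𝒞.1 hℓ]
  exact iterated_kk h𝒜 hc.le h𝒞

/-- Among initial segments of the colex order, cardinality determines inclusion. -/
lemma isInitSeg_subset_of_card_le {α : Type*} [LinearOrder α] {𝒞 𝒟 : Finset (Finset α)} {r : ℕ}
    (h𝒞 : IsInitSeg 𝒞 r) (h𝒟 : IsInitSeg 𝒟 r) (h : #𝒞 ≤ #𝒟) : 𝒞 ⊆ 𝒟 := by
  rcases h𝒞.total h𝒟 with h1 | h1
  · exact h1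
  · exact (eq_of_subset_of_card_le h1 h).ge

/-- Shadows of families with at most `m.choose r` members are at least proportional to those of
all `r`-subsets of an `m`-set. -/
lemma card_mul_choose_le_of_card_le {n m r ℓ : ℕ} {𝒜 : Finset (Finset (Fin n))}
    (h𝒜 : (𝒜 : Set (Finset (Fin n))).Sized r) (hℓ : ℓ ≤ r) (hm : m ≤ n)
    (hcard : #𝒜 ≤ m.choose r) :
    #𝒜 * m.choose ℓ ≤ #(lowerShadow ℓ 𝒜) * m.choose r := by
  obtain ⟨𝒞, h𝒞, hc, hs⟩ := exists_isInitSeg_le_lowerShadow h𝒜 hℓ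
  have hsub := isInitSeg_subset_of_card_le h𝒞 (isInitSeg_powersetCard_finPrefix n m r)
    (by rw [card_powersetCard, card_finPrefix hm, hc]; exact hcard)
  have := card_mul_choose_le_card_lowerShadow_mul hsub hℓ
  rw [card_finPrefix hm, hc] at this
  exact this.trans (Nat.mul_le_mul_right _ hs)

/-- Between `m.choose r` and `(m + 1).choose r`, the minimum shadow size lies above the chord. -/
lemma chord_le_card_lowerShadow {n m r ℓ : ℕ} {𝒜 : Finset (Finset (Fin n))}
    (h𝒜 : (𝒜 : Set (Finset (Fin n))).Sized (r + 1)) (hℓ : ℓ ≤ r) (hm : m + 1 ≤ n)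
    (hmr : r + 1 ≤ m) (hlow : m.choose (r + 1) ≤ #𝒜) (hcard : #𝒜 ≤ (m + 1).choose (r + 1)) :
    #𝒜 * m.choose ℓ + m.choose (ℓ + 1) * m.choose r ≤
      #(lowerShadow (ℓ + 1) 𝒜) * m.choose r + m.choose (r + 1) * m.choose ℓ := by
  obtain ⟨𝒞, h𝒞, hc, hs⟩ := exists_isInitSeg_le_lowerShadow h𝒜 (Nat.succ_le_succ hℓ)
  have hsub := isInitSeg_subset_of_card_le h𝒞 (isInitSeg_powersetCard_finPrefix n (m + 1) (r + 1))
    (by rw [card_powersetCard, card_finPrefix hm, hc]; exact hcard)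
  have hsup := isInitSeg_subset_of_card_le (isInitSeg_powersetCard_finPrefix n m (r + 1)) h𝒞
    (by rw [card_powersetCard, card_finPrefix (by omega), hc]; exact hlow)
  set z : Fin n := ⟨m, hm⟩ with hz
  set Y := finPrefix n m with hY
  have hcY : #Y = m := card_finPrefix (by omega)
  have hzY : z ∉ Y := by simp [hY, finPrefix, hz]
  have hins : finPrefix n (m + 1) = insert z Y := by
    ext i
    simp only [hY, finPrefix, mem_filter, mem_univ, true_and, mem_insert, hz, Fin.ext_iff]
    omega
  set 𝒟 := {C ∈ 𝒞 | z ∈ C}.image (fun C => C.erase z) with h𝒟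
  have hinj : Set.InjOn (fun C : Finset (Fin n) => C.erase z)
      ({C ∈ 𝒞 | z ∈ C} : Finset (Finset (Fin n))) := by
    intro A hA B hB h
    simp only [coe_filter, Set.mem_ofPred_eq] at hA hB
    rw [← insert_erase hA.2, ← insert_erase hB.2]
    exact congrArg _ h
  have hc𝒟 : #𝒟 = #{C ∈ 𝒞 | z ∈ C} := card_image_of_injOn hinj
  have hnot : {C ∈ 𝒞 | z ∉ C} = powersetCard (r + 1) Y := by
    ext C
    rw [mem_filter]
    constructor
    · rintro ⟨h1, h2⟩
      obtain ⟨h3, h4⟩ := mem_powersetCard.1 (hsub h1)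
      rw [hins, subset_insert_iff_of_notMem h2] at h3
      exact mem_powersetCard.2 ⟨h3, h4⟩
    · intro h
      exact ⟨hsup h, fun h2 => hzY ((mem_powersetCard.1 h).1 h2)⟩
  have hsplit : #𝒟 + m.choose (r + 1) = #𝒞 := by
    rw [hc𝒟, ← card_filter_add_card_filter_not (s := 𝒞) (fun C => z ∈ C), hnot, card_powersetCard,
      hcY]
  have h𝒟sub : 𝒟 ⊆ powersetCard r Y := by
    intro D hD
    obtain ⟨C, hC, rfl⟩ := mem_image.1 hD
    obtain ⟨hC, hzC⟩ := mem_filter.1 hC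
    obtain ⟨h3, h4⟩ := mem_powersetCard.1 (hsub hC)
    rw [mem_powersetCard, card_erase_of_mem hzC, h4]
    refine ⟨?_, rfl⟩
    rw [hins] at h3
    exact subset_insert_iff.1 h3
  have hlym := card_mul_choose_le_card_lowerShadow_mul h𝒟sub hℓ
  rw [hcY] at hlym
  have hshadow : m.choose (ℓ + 1) + #(lowerShadow ℓ 𝒟) ≤ #(lowerShadow (ℓ + 1) 𝒞) := by
    have hS : ∀ S ∈ lowerShadow ℓ 𝒟, z ∉ S := by
      intro S hS hzS
      obtain ⟨-, D, hD, hSD⟩ := mem_lowerShadow.1 hS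
      exact hzY ((mem_powersetCard.1 (h𝒟sub hD)).1 (hSD hzS))
    have himg : #((lowerShadow ℓ 𝒟).image (insert z)) = #(lowerShadow ℓ 𝒟) := by
      apply card_image_of_injOn
      intro A hA B hB h
      rw [← erase_insert (hS A hA), ← erase_insert (hS B hB)]
      exact congrArg (fun C => C.erase z) h
    rw [← himg, ← hcY, ← card_powersetCard, ← card_union_of_disjoint]
    · refine card_le_card (union_subset (fun S hS' => ?_) (fun S hS' => ?_))
      · obtain ⟨h1, h2⟩ := mem_powersetCard.1 hS'
        obtain ⟨B, hSB, hBY, hB⟩ := exists_subsuperset_card_eq h1 (n := r + 1) (by omega)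
          (by omega)
        exact mem_lowerShadow.2 ⟨h2, B, hsup (mem_powersetCard.2 ⟨hBY, hB⟩), hSB⟩
      · obtain ⟨T, hT, rfl⟩ := mem_image.1 hS'
        obtain ⟨h1, D, hD, hTD⟩ := mem_lowerShadow.1 hT
        obtain ⟨C, hC, rfl⟩ := mem_image.1 hD
        obtain ⟨hC, hzC⟩ := mem_filter.1 hC
        refine mem_lowerShadow.2 ⟨by rw [card_insert_of_notMem (hS T hT), h1], C, hC, ?_⟩
        exact insert_subset hzC (hTD.trans (erase_subset _ _))
    · rw [disjoint_left]
      intro A hA hA'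
      obtain ⟨T, -, rfl⟩ := mem_image.1 hA'
      exact hzY ((mem_powersetCard.1 hA).1 (mem_insert_self _ _))
  nlinarith [Nat.mul_le_mul_right (m.choose r) hshadow, Nat.mul_le_mul_right (m.choose r) hs]

end Fin

lemma exists_fin_transport {X : Finset ℕ} {𝒜 : Finset (Finset ℕ)} {r : ℕ}
    (h𝒜 : 𝒜 ⊆ powersetCard r X) (ℓ : ℕ) :
    ∃ 𝒜' : Finset (Finset (Fin #X)), (𝒜' : Set (Finset (Fin #X))).Sized r ∧ #𝒜' = #𝒜 ∧
      #(lowerShadow ℓ 𝒜') ≤ #(lowerShadow ℓ 𝒜) := by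
  set e : Fin #X ↪ ℕ := (X.orderEmbOfFin rfl).toEmbedding with he
  have hinj : Function.Injective (Finset.map e) := map_injective e
  refine ⟨univ.filter (fun S => S.map e ∈ 𝒜), ?_, ?_, ?_⟩
  · intro S hS
    have := (mem_powersetCard.1 (h𝒜 (by simpa using hS))).2
    simpa using this
  · rw [← card_image_of_injective _ hinj]
    congr 1
    ext A
    simp only [mem_image, mem_filter, mem_univ, true_and]
    refine ⟨by rintro ⟨S, hS, rfl⟩; exact hS, fun hA => ?_⟩
    refine ⟨univ.filter (fun i => e i ∈ A), ?_⟩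
    have : (univ.filter (fun i => e i ∈ A)).map e = A := by
      ext x
      simp only [mem_map, mem_filter, mem_univ, true_and]
      refine ⟨by rintro ⟨i, hi, rfl⟩; exact hi, fun hx => ?_⟩
      have hxX : x ∈ Set.range (X.orderEmbOfFin rfl) := by
        rw [range_orderEmbOfFin]
        exact (mem_powersetCard.1 (h𝒜 hA)).1 hx
      obtain ⟨i, rfl⟩ := hxX
      exact ⟨i, hx, rfl⟩
    exact ⟨this.symm ▸ hA, this⟩
  · rw [← card_image_of_injective (lowerShadow ℓ _) hinj]
    refine card_le_card fun S hS => ?_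
    obtain ⟨T, hT, rfl⟩ := mem_image.1 hS
    obtain ⟨hc, A, hA, hTA⟩ := mem_lowerShadow.1 hT
    exact mem_lowerShadow.2 ⟨by rw [card_map, hc], A.map e, by simpa using hA, map_subset_map.2 hTA⟩

/-- The complements of the members of one of two cross-intersecting families have a shadow
disjoint from the other family. -/
lemma CrossIntersecting.card_add_card_lowerShadow_le {X : Finset ℕ} {𝒜 ℬ : Finset (Finset ℕ)}
    {a b : ℕ} (h𝒜 : 𝒜 ⊆ powersetCard a X) (hℬ : ℬ ⊆ powersetCard b X)
    (h : CrossIntersecting 𝒜 ℬ) :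
    ℬ.image (X \ ·) ⊆ powersetCard (#X - b) X ∧ #(ℬ.image (X \ ·)) = #ℬ ∧
      #𝒜 + #(lowerShadow a (ℬ.image (X \ ·))) ≤ (#X).choose a := by
  refine ⟨?_, ?_, ?_⟩
  · intro D hD
    obtain ⟨B, hB, rfl⟩ := mem_image.1 hD
    obtain ⟨h1, h2⟩ := mem_powersetCard.1 (hℬ hB)
    exact mem_powersetCard.2 ⟨sdiff_subset, by rw [card_sdiff_of_subset h1, h2]⟩
  · refine card_image_of_injOn fun A hA B hB hAB => ?_
    have h1 := (mem_powersetCard.1 (hℬ hA)).1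
    have h2 := (mem_powersetCard.1 (hℬ hB)).1
    rw [← Finset.sdiff_sdiff_eq_self h1, ← Finset.sdiff_sdiff_eq_self h2]
    exact congrArg (X \ ·) hAB
  · rw [← card_powersetCard, ← card_union_of_disjoint]
    · refine card_le_card (union_subset h𝒜 fun S hS => ?_)
      obtain ⟨hc, D, hD, hSD⟩ := mem_lowerShadow.1 hS
      obtain ⟨B, hB, rfl⟩ := mem_image.1 hD
      exact mem_powersetCard.2 ⟨hSD.trans sdiff_subset, hc⟩
    · rw [disjoint_left]
      intro A hA hA'
      obtain ⟨-, D, hD, hSD⟩ := mem_lowerShadow.1 hA'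
      obtain ⟨B, hB, rfl⟩ := mem_image.1 hD
      obtain ⟨x, hx⟩ := h A hA B hB
      rw [mem_inter] at hx
      exact (mem_sdiff.1 (hSD hx.1)).2 hx.2

/-- A linear bound on cross-intersecting families, one of which is small. -/
lemma CrossIntersecting.card_mul_add_card_mul_le {X : Finset ℕ} {𝒜 ℬ : Finset (Finset ℕ)}
    {a b m : ℕ} (h𝒜 : 𝒜 ⊆ powersetCard a X) (hℬ : ℬ ⊆ powersetCard b X)
    (h : CrossIntersecting 𝒜 ℬ) (hab : a + b ≤ #X) (hm : m ≤ #X)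
    (hcard : #ℬ ≤ m.choose (#X - b)) :
    #ℬ * m.choose a + #𝒜 * m.choose (#X - b) ≤ (#X).choose a * m.choose (#X - b) := by
  obtain ⟨h𝒟, hc, hsh⟩ := h.card_add_card_lowerShadow_le h𝒜 hℬ
  obtain ⟨𝒟', hs', hc', hshX⟩ := exists_fin_transport h𝒟 a
  have := card_mul_choose_le_of_card_le hs' (ℓ := a) (by omega) hm (by omega)
  rw [hc', hc] at this
  nlinarith [Nat.mul_le_mul_right (m.choose (#X - b)) hsh,
    Nat.mul_le_mul_right (m.choose (#X - b)) hshX]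

/-- A linear bound on cross-intersecting families, one of which has a size between two
consecutive binomial coefficients. -/
lemma CrossIntersecting.chord_le {X : Finset ℕ} {𝒜 ℬ : Finset (Finset ℕ)}
    {ℓ b m r : ℕ} (h𝒜 : 𝒜 ⊆ powersetCard (ℓ + 1) X) (hℬ : ℬ ⊆ powersetCard b X)
    (h : CrossIntersecting 𝒜 ℬ) (hr : r + 1 + b = #X) (hℓ : ℓ ≤ r) (hm : m + 1 ≤ #X)
    (hrm : r + 1 ≤ m) (hlow : m.choose (r + 1) ≤ #ℬ) (hcard : #ℬ ≤ (m + 1).choose (r + 1)) :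
    #ℬ * m.choose ℓ + (m.choose (ℓ + 1) + #𝒜) * m.choose r ≤
      (#X).choose (ℓ + 1) * m.choose r + m.choose (r + 1) * m.choose ℓ := by
  obtain ⟨h𝒟, hc, hsh⟩ := h.card_add_card_lowerShadow_le h𝒜 hℬ
  rw [show #X - b = r + 1 by omega] at h𝒟
  obtain ⟨𝒟', hs', hc', hshX⟩ := exists_fin_transport h𝒟 (ℓ + 1)
  have := chord_le_card_lowerShadow hs' hℓ hm hrm (by omega) (by omega)
  rw [hc', hc] at this
  nlinarith [Nat.mul_le_mul_right (m.choose r) hsh, Nat.mul_le_mul_right (m.choose r) hshX]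

lemma card_inter_Icc_add_card_filter_lt {B : Finset ℕ} {n : ℕ} (hB : B ⊆ Icc 1 n) (m : ℕ) :
    #(B ∩ Icc 1 m) + #{x ∈ B | m < x} = #B := by
  rw [← card_filter_add_card_filter_not (s := B) (fun x => x ≤ m)]
  congr 2
  · ext x
    have := @hB x
    simp only [mem_inter, mem_Icc, mem_filter] at this ⊢
    constructor
    · rintro ⟨h1, h2⟩; exact ⟨h1, h2.2⟩
    · rintro ⟨h1, h2⟩; exact ⟨h1, (this h1).1, h2⟩
  · ext x; simp

/-- If every member of an `(ℓ + i)`-uniform family on `[N]` has an initial interval on which it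
exceeds half by a margin controlled by `i`, then its `ℓ`-shadow is large. -/
lemma mul_card_le_mul_card_lowerShadow {i N : ℕ} : ∀ {ℓ : ℕ} {𝒜 : Finset (Finset ℕ)},
    2 * ℓ + i ≤ N + 1 → 𝒜 ⊆ powersetCard (ℓ + i) (Icc 1 N) →
    (∀ A ∈ 𝒜, ∃ m ≤ N, m + i + 1 ≤ 2 * #(A ∩ Icc 1 m)) →
    (ℓ + i) * #𝒜 ≤ ℓ * #(lowerShadow ℓ 𝒜) := by
  have hpos : ∀ {N ℓ : ℕ} {𝒜 : Finset (Finset ℕ)}, 𝒜 ⊆ powersetCard (ℓ + i) (Icc 1 N) →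
      (∀ A ∈ 𝒜, ∃ m ≤ N, m + i + 1 ≤ 2 * #(A ∩ Icc 1 m)) → ℓ = 0 → 𝒜 = ∅ := by
    rintro N ℓ 𝒜 h𝒜 hhit rfl
    refine eq_empty_of_forall_notMem fun A hA => ?_
    obtain ⟨m, -, h1⟩ := hhit A hA
    have h2 := (mem_powersetCard.1 (h𝒜 hA)).2
    have h3 : #(A ∩ Icc 1 m) ≤ #A := card_le_card inter_subset_left
    have h4 : #(A ∩ Icc 1 m) ≤ #(Icc 1 m) := card_le_card inter_subset_right
    rw [Nat.card_Icc] at h4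
    omega
  have base : ∀ {N ℓ : ℕ} {𝒜 : Finset (Finset ℕ)}, 2 * ℓ + i = N + 1 → 1 ≤ ℓ →
      𝒜 ⊆ powersetCard (ℓ + i) (Icc 1 N) → (ℓ + i) * #𝒜 ≤ ℓ * #(lowerShadow ℓ 𝒜) := by
    intro N ℓ 𝒜 hN hℓ h𝒜
    have h1 := card_mul_choose_le_card_lowerShadow_mul h𝒜 (Nat.le_add_right ℓ i)
    obtain ⟨p, rfl⟩ : ∃ p, ℓ = p + 1 := ⟨ℓ - 1, by omega⟩
    rw [Nat.card_Icc, Nat.add_sub_cancel] at h1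
    have h2 : N.choose (p + 1 + i) = N.choose p := by
      rw [← Nat.choose_symm_of_eq_add]; omega
    have h3 := Nat.choose_succ_right_eq N p
    rw [show N - p = p + 1 + i by omega] at h3
    have h4 : 0 < N.choose p := Nat.choose_pos (by omega)
    rw [h2] at h1
    refine Nat.le_of_mul_le_mul_right ?_ h4
    calc (p + 1 + i) * #𝒜 * N.choose p = #𝒜 * N.choose (p + 1) * (p + 1) := by
          rw [mul_assoc #𝒜, h3]; ring
      _ ≤ #(lowerShadow (p + 1) 𝒜) * N.choose p * (p + 1) := Nat.mul_le_mul_right _ h1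
      _ = _ := by ring
  induction N with
  | zero =>
    intro ℓ 𝒜 hN h𝒜 hhit
    rcases Nat.eq_zero_or_pos ℓ with h0 | h0
    · simp [hpos h𝒜 hhit h0]
    · omega
  | succ N ih =>
    intro ℓ 𝒜 hN h𝒜 hhit
    rcases Nat.eq_zero_or_pos ℓ with h0 | h0
    · simp [hpos h𝒜 hhit h0]
    rcases hN.eq_or_lt with hN | hN
    · exact base hN h0 h𝒜
    obtain ⟨p, rfl⟩ : ∃ p, ℓ = p + 1 := ⟨ℓ - 1, by omega⟩
    have hhit' : ∀ A ∈ 𝒜, ∃ m ≤ N, m + i + 1 ≤ 2 * #(A ∩ Icc 1 m) := by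
      intro A hA
      obtain ⟨m, hm, h1⟩ := hhit A hA
      refine ⟨m, ?_, h1⟩
      have h2 := (mem_powersetCard.1 (h𝒜 hA)).2
      have h3 : #(A ∩ Icc 1 m) ≤ #A := card_le_card inter_subset_left
      omega
    set 𝒜₀ := 𝒜.nonMemberSubfamily (N + 1)
    set 𝒜₁ := 𝒜.memberSubfamily (N + 1)
    have hIcc : Icc 1 (N + 1) = insert (N + 1) (Icc 1 N) := by
      ext x; simp only [mem_Icc, mem_insert]; omega
    have h0sub : 𝒜₀ ⊆ powersetCard (p + 1 + i) (Icc 1 N) := by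
      intro A hA
      obtain ⟨h1, h2⟩ := mem_nonMemberSubfamily.1 hA
      obtain ⟨h3, h4⟩ := mem_powersetCard.1 (h𝒜 h1)
      rw [hIcc, subset_insert_iff_of_notMem h2] at h3
      exact mem_powersetCard.2 ⟨h3, h4⟩
    have h1sub : 𝒜₁ ⊆ powersetCard (p + i) (Icc 1 N) := by
      intro A hA
      obtain ⟨h1, h2⟩ := mem_memberSubfamily.1 hA
      obtain ⟨h3, h4⟩ := mem_powersetCard.1 (h𝒜 h1)
      rw [hIcc, insert_subset_insert_iff h2] at h3
      rw [card_insert_of_notMem h2] at h4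
      exact mem_powersetCard.2 ⟨h3, by omega⟩
    have h1hit : ∀ A ∈ 𝒜₁, ∃ m ≤ N, m + i + 1 ≤ 2 * #(A ∩ Icc 1 m) := by
      intro A hA
      obtain ⟨h1, h2⟩ := mem_memberSubfamily.1 hA
      obtain ⟨m, hm, h3⟩ := hhit' _ h1
      rw [insert_inter_of_notMem (by simp; omega)] at h3
      exact ⟨m, hm, h3⟩
    have ih0 := ih (by omega) h0sub fun A hA => hhit' A (mem_nonMemberSubfamily.1 hA).1
    have ih1 := ih (by omega) h1sub h1hit
    have ih1' : (p + 1 + i) * #𝒜₁ ≤ (p + 1) * #(lowerShadow p 𝒜₁) := by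
      rcases Nat.eq_zero_or_pos p with hp | hp
      · simp [hpos h1sub h1hit hp]
      · have : #𝒜₁ ≤ #(lowerShadow p 𝒜₁) := by
          refine Nat.le_of_mul_le_mul_left ?_ hp
          nlinarith
        nlinarith
    have hsh : #(lowerShadow (p + 1) 𝒜₀) + #(lowerShadow p 𝒜₁) ≤ #(lowerShadow (p + 1) 𝒜) := by
      have hS : ∀ S ∈ lowerShadow p 𝒜₁, N + 1 ∉ S := by
        intro S hS hNS
        obtain ⟨-, A, hA, hSA⟩ := mem_lowerShadow.1 hS
        exact (mem_memberSubfamily.1 hA).2 (hSA hNS)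
      have himg : #((lowerShadow p 𝒜₁).image (insert (N + 1))) = #(lowerShadow p 𝒜₁) := by
        apply card_image_of_injOn
        intro A hA B hB h
        rw [← erase_insert (hS A hA), ← erase_insert (hS B hB)]
        exact congrArg (fun C => C.erase (N + 1)) h
      rw [← himg, ← card_union_of_disjoint]
      · refine card_le_card (union_subset (lowerShadow_mono fun A hA =>
          (mem_nonMemberSubfamily.1 hA).1) fun S hS' => ?_)
        obtain ⟨T, hT, rfl⟩ := mem_image.1 hS'
        obtain ⟨h1, A, hA, hTA⟩ := mem_lowerShadow.1 hT
        exact mem_lowerShadow.2 ⟨by rw [card_insert_of_notMem (hS T hT), h1], _,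
          (mem_memberSubfamily.1 hA).1, insert_subset_insert _ hTA⟩
      · rw [disjoint_left]
        intro S hS1 hS2
        obtain ⟨T, -, rfl⟩ := mem_image.1 hS2
        obtain ⟨-, A, hA, hSA⟩ := mem_lowerShadow.1 hS1
        exact (mem_nonMemberSubfamily.1 hA).2 (hSA (mem_insert_self _ _))
    have hc := card_memberSubfamily_add_card_nonMemberSubfamily (N + 1) 𝒜
    calc (p + 1 + i) * #𝒜 = (p + 1 + i) * #𝒜₁ + (p + 1 + i) * #𝒜₀ := by rw [← hc]; ring
      _ ≤ (p + 1) * #(lowerShadow p 𝒜₁) + (p + 1) * #(lowerShadow (p + 1) 𝒜₀) :=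
          add_le_add ih1' ih0
      _ = (p + 1) * (#(lowerShadow (p + 1) 𝒜₀) + #(lowerShadow p 𝒜₁)) := by ring
      _ ≤ _ := Nat.mul_le_mul_left _ hsh

/-- A family is right-shifted on `[n]` when replacing an element of a member by a larger one
gives a member. -/
def IsRightShifted (n : ℕ) (F : Finset (Finset ℕ)) : Prop :=
  ∀ A ∈ F, ∀ i ∈ A, ∀ j ∈ Icc 1 n, i < j → j ∉ A → insert j (A.erase i) ∈ F

/-- Right-shifted families are closed under passing to sets with larger tails. -/
lemma IsRightShifted.mem_of_card_filter_le {n : ℕ} {F : Finset (Finset ℕ)}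
    (hF : IsRightShifted n F) {C : Finset ℕ} (hC : C ⊆ Icc 1 n) :
    ∀ {B : Finset ℕ}, B ∈ F → B ⊆ Icc 1 n → #B = #C →
      (∀ m, #{x ∈ B | m < x} ≤ #{x ∈ C | m < x}) → C ∈ F := by
  intro B
  induction h : #(B \ C) generalizing B with
  | zero =>
    intro hB _ hBC _
    rw [card_eq_zero, sdiff_eq_empty_iff_subset] at h
    rwa [← eq_of_subset_of_card_le h hBC.ge]
  | succ d ih =>
    intro hB hBn hBC htail
    have hne : (B \ C).Nonempty := card_pos.1 (by omega)
    obtain ⟨hx, hxmax⟩ := (B \ C).isGreatest_max' hne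
    set x := (B \ C).max' hne with hxdef
    rw [mem_coe, mem_sdiff] at hx
    have hx1 : 1 ≤ x := (mem_Icc.1 (hBn hx.1)).1
    have hy : ∃ y ∈ C, x < y ∧ y ∉ B := by
      by_contra! hcon
      have h1 : {y ∈ C | x - 1 < y} ⊂ {y ∈ B | x - 1 < y} := by
        rw [ssubset_iff_of_subset]
        · exact ⟨x, mem_filter.2 ⟨hx.1, by omega⟩, fun h => hx.2 (mem_filter.1 h).1⟩
        · intro y hy
          rw [mem_filter] at hy ⊢
          have : y ≠ x := by rintro h; exact hx.2 (h ▸ hy.1)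
          exact ⟨hcon y hy.1 (by omega), hy.2⟩
      exact absurd (htail (x - 1)) (not_le.2 (card_lt_card h1))
    obtain ⟨y, hyC, hxy, hyB⟩ := hy
    have hmem := hF B hB x hx.1 y (hC hyC) hxy hyB
    have hye : y ∉ B.erase x := fun h => hyB (mem_of_mem_erase h)
    refine ih ?_ hmem ?_ ?_ ?_
    · have : insert y (B.erase x) \ C = (B \ C).erase x := by
        ext z
        simp only [mem_sdiff, mem_insert, mem_erase]
        constructor
        · rintro ⟨rfl | h1, h2⟩
          · exact absurd hyC h2
          · exact ⟨h1.1, h1.2, h2⟩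
        · rintro ⟨h1, h2, h3⟩
          exact ⟨Or.inr ⟨h1, h2⟩, h3⟩
      rw [this, card_erase_of_mem (mem_sdiff.2 hx), h, Nat.add_sub_cancel]
    · exact insert_subset (hC hyC) ((erase_subset _ _).trans hBn)
    · rw [card_insert_of_notMem hye, card_erase_of_mem hx.1, ← hBC]
      have : 0 < #B := card_pos.2 ⟨x, hx.1⟩
      omega
    · intro m
      by_cases hm : x ≤ m ∧ m < y
      · apply card_le_card
        intro z hz
        rw [mem_filter, mem_insert, mem_erase] at hz
        rw [mem_filter]
        refine ⟨?_, hz.2⟩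
        rcases hz.1 with rfl | hz'
        · exact hyC
        · by_contra hzC
          have := hxmax (mem_coe.2 (mem_sdiff.2 ⟨hz'.2, hzC⟩))
          omega
      · refine le_trans (le_of_eq ?_) (htail m)
        rw [filter_insert, filter_erase]
        by_cases hmx : m < x
        · have hxm : x ∈ {z ∈ B | m < z} := mem_filter.2 ⟨hx.1, hmx⟩
          rw [if_pos (hmx.trans hxy), card_insert_of_notMem, card_erase_of_mem hxm]
          · have : 0 < #{z ∈ B | m < z} := card_pos.2 ⟨x, hxm⟩
            omega
          · exact fun h => hyB (mem_filter.1 (mem_of_mem_erase h)).1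
        · rw [if_neg (by omega), erase_eq_of_notMem]
          exact fun h => hmx (mem_filter.1 h).2

/-- A member of a right-shifted intersecting family that misses the last point has a large tail. -/
lemma IsRightShifted.exists_large_tail {n k : ℕ} {F : Finset (Finset ℕ)}
    (hF : IsRightShifted n F) (hsub : F ⊆ powersetCard k (Icc 1 n)) (hint : IntersectingFam F)
    (hk : 1 ≤ k) (hn : 2 * k ≤ n) {B : Finset ℕ} (hB : B ∈ F) :
    ∃ m < n, n - m + 1 ≤ 2 * #{x ∈ B | m < x} := by
  by_contra! hcon
  obtain ⟨hBn, hBk⟩ := mem_powersetCard.1 (hsub hB)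
  set E := Icc 1 n \ B with hE
  have hEB : ∀ m, #{x ∈ E | m < x} + #{x ∈ B | m < x} = n - m := by
    intro m
    rw [← card_union_of_disjoint, ← filter_union, hE, sdiff_union_of_subset hBn]
    · have : {x ∈ Icc 1 n | m < x} = Ioc m n := by
        ext x; simp only [mem_filter, mem_Icc, mem_Ioc]; omega
      rw [this, Nat.card_Ioc]
    · exact disjoint_filter_filter sdiff_disjoint
  have hBle : ∀ m, #{x ∈ B | m < x} ≤ k := fun m => hBk ▸ card_filter_le _ _
  have hE0 : k ≤ #{x ∈ E | 0 < x} := by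
    have := hEB 0
    have := hBle 0
    omega
  set P : ℕ → Prop := fun m => k ≤ #{x ∈ E | m < x} with hP
  set m₀ := Nat.findGreatest P n with hm₀
  have hPm : P m₀ := Nat.findGreatest_spec (P := P) (Nat.zero_le n) hE0
  have hm₀n : m₀ < n := by
    by_contra hlt
    have := hEB m₀
    simp only [hP] at hPm
    omega
  have hnP : ¬ P (m₀ + 1) := Nat.findGreatest_is_greatest (Nat.lt_succ_self _) hm₀n
  have hstep : #{x ∈ E | m₀ < x} ≤ #{x ∈ E | m₀ + 1 < x} + 1 := by
    refine (card_le_card (t := {x ∈ E | m₀ + 1 < x} ∪ {m₀ + 1}) fun x hx => ?_).trans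
      ((card_union_le _ _).trans (by rw [card_singleton]))
    simp only [mem_filter, mem_union, mem_singleton] at hx ⊢
    by_cases hx' : x = m₀ + 1
    · exact Or.inr hx'
    · exact Or.inl ⟨hx.1, by omega⟩
  have hCk : #{x ∈ E | m₀ < x} = k := by
    simp only [hP] at hPm hnP
    omega
  have hCF : {x ∈ E | m₀ < x} ∈ F := by
    refine hF.mem_of_card_filter_le ((filter_subset _ _).trans sdiff_subset) hB hBn
      (hBk.trans hCk.symm) fun m => ?_
    rw [filter_filter]
    rcases lt_or_ge m m₀ with h | h
    · have : {x ∈ E | m₀ < x ∧ m < x} = {x ∈ E | m₀ < x} := by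
        apply filter_congr; intro x _; omega
      rw [this, hCk]
      exact hBle m
    · have : {x ∈ E | m₀ < x ∧ m < x} = {x ∈ E | m < x} := by
        apply filter_congr; intro x _; omega
      rw [this]
      have h1 := hEB m
      rcases lt_or_ge m n with hmn | hmn
      · have := hcon m hmn
        omega
      · omega
  obtain ⟨x, hx⟩ := hint _ hCF _ hB
  rw [mem_inter, mem_filter, hE, mem_sdiff] at hx
  exact hx.1.1.2 hx.2

lemma IntersectingFam.crossIntersecting_memberSubfamily {F : Finset (Finset ℕ)}
    (hint : IntersectingFam F) (x : ℕ) :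
    CrossIntersecting (F.memberSubfamily x) (F.nonMemberSubfamily x) := by
  intro A hA B hB
  rw [mem_memberSubfamily] at hA
  rw [mem_nonMemberSubfamily] at hB
  obtain ⟨y, hy⟩ := hint _ hA.1 _ hB.1
  rw [mem_inter, mem_insert] at hy
  refine ⟨y, mem_inter.2 ⟨hy.1.resolve_left ?_, hy.2⟩⟩
  rintro rfl
  exact hB.2 hy.2

lemma memberSubfamily_subset_powersetCard {F : Finset (Finset ℕ)} {X : Finset ℕ} {k x : ℕ}
    (hF : F ⊆ powersetCard k X) : F.memberSubfamily x ⊆ powersetCard (k - 1) (X.erase x) := by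
  intro A hA
  rw [mem_memberSubfamily] at hA
  obtain ⟨h1, h2⟩ := mem_powersetCard.1 (hF hA.1)
  rw [card_insert_of_notMem hA.2] at h2
  exact mem_powersetCard.2 ⟨subset_erase.2 ⟨(subset_insert _ _).trans h1, hA.2⟩, by omega⟩

lemma nonMemberSubfamily_subset_powersetCard {F : Finset (Finset ℕ)} {X : Finset ℕ} {k x : ℕ}
    (hF : F ⊆ powersetCard k X) : F.nonMemberSubfamily x ⊆ powersetCard k (X.erase x) := by
  intro A hA
  rw [mem_nonMemberSubfamily] at hA
  obtain ⟨h1, h2⟩ := mem_powersetCard.1 (hF hA.1)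
  exact mem_powersetCard.2 ⟨subset_erase.2 ⟨h1, hA.2⟩, h2⟩

/-- A weighted bound on right-shifted intersecting families. -/
lemma IsRightShifted.card_bound {n k : ℕ} {F : Finset (Finset ℕ)}
    (hF : IsRightShifted n F) (hsub : F ⊆ powersetCard k (Icc 1 n)) (hint : IntersectingFam F)
    (hk : 1 ≤ k) (hn : 2 * k ≤ n) :
    (n - 1 - k) * #(F.nonMemberSubfamily n) + (k - 1) * #(F.memberSubfamily n) ≤
      (k - 1) * (n - 1).choose (k - 1) := by
  have hX : (Icc 1 n).erase n = Icc 1 (n - 1) := by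
    ext x; simp only [mem_erase, mem_Icc]; omega
  have h1 := memberSubfamily_subset_powersetCard (x := n) hsub
  have h2 := nonMemberSubfamily_subset_powersetCard (x := n) hsub
  rw [hX] at h1 h2
  obtain ⟨h3, h4, h5⟩ :=
    (hint.crossIntersecting_memberSubfamily n).card_add_card_lowerShadow_le h1 h2
  rw [Nat.card_Icc, Nat.add_sub_cancel] at h3 h5
  have key := mul_card_le_mul_card_lowerShadow (i := n - 2 * k) (ℓ := k - 1) (N := n - 1)
    (𝒜 := (F.nonMemberSubfamily n).image (Icc 1 (n - 1) \ ·)) (by omega) (by rw [show k - 1 + (n - 2 * k) = n - 1 - k by omega]; exact h3) (by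
      intro D hD
      obtain ⟨B, hB, rfl⟩ := mem_image.1 hD
      have hBF := (mem_nonMemberSubfamily.1 hB).1
      obtain ⟨hB1, hB2⟩ := mem_powersetCard.1 (h2 hB)
      obtain ⟨m, hm, hmB⟩ := hF.exists_large_tail hsub hint hk hn hBF
      refine ⟨m, by omega, ?_⟩
      have h6 := card_inter_Icc_add_card_filter_lt hB1 m
      have h7 : (Icc 1 (n - 1) \ B) ∩ Icc 1 m = Icc 1 m \ (B ∩ Icc 1 m) := by
        ext x
        have : x ≤ m → x ≤ n - 1 := by omega
        simp only [mem_inter, mem_sdiff, mem_Icc]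
        tauto
      rw [h7, card_sdiff_of_subset inter_subset_right, Nat.card_Icc]
      omega)
  rw [h4, show k - 1 + (n - 2 * k) = n - 1 - k by omega] at key
  calc _ ≤ (k - 1) * #(lowerShadow (k - 1) ((F.nonMemberSubfamily n).image (Icc 1 (n - 1) \ ·))) +
        (k - 1) * #(F.memberSubfamily n) := Nat.add_le_add_right key _
    _ = (k - 1) * (#(F.memberSubfamily n) +
        #(lowerShadow (k - 1) ((F.nonMemberSubfamily n).image (Icc 1 (n - 1) \ ·)))) := by ring
    _ ≤ _ := Nat.mul_le_mul_left _ h5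

section Shift
open UV

lemma mem_compression_singleton {F : Finset (Finset ℕ)} {i j : ℕ} (hij : i ≠ j) {A : Finset ℕ} :
    A ∈ compression {j} {i} F ↔
      (A ∈ F ∧ (i ∈ A → j ∉ A → insert j (A.erase i) ∈ F)) ∨
        (A ∉ F ∧ j ∈ A ∧ i ∉ A ∧ insert i (A.erase j) ∈ F) := by
  have hc : ∀ B : Finset ℕ, j ∉ B → i ∈ B → compress {j} {i} B = insert j (B.erase i) := by
    intro B hj hi
    rw [compress, if_pos ⟨by simpa using hj, by simpa using hi⟩]
    ext x
    simp only [sup_eq_union, mem_sdiff, mem_union, mem_singleton, mem_insert, mem_erase]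
    grind
  have hc' : ∀ B : Finset ℕ, ¬ (j ∉ B ∧ i ∈ B) → compress {j} {i} B = B := by
    intro B hB
    rw [compress, if_neg]
    simpa using hB
  rw [mem_compression]
  refine or_congr (and_congr_right fun hA => ?_) (and_congr_right fun hA => ?_)
  · by_cases h : j ∉ A ∧ i ∈ A
    · rw [hc A h.1 h.2]; tauto
    · rw [hc' A h]; tauto
  · constructor
    · rintro ⟨B, hB, rfl⟩
      by_cases h : j ∉ B ∧ i ∈ B
      · rw [hc B h.1 h.2]
        have : insert i ((insert j (B.erase i)).erase j) = B := by
          rw [erase_insert (fun h' => h.1 (mem_of_mem_erase h')), insert_erase h.2]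
        rw [this]
        refine ⟨mem_insert_self _ _, ?_, hB⟩
        simp [hij]
      · rw [hc' B h] at hA
        exact absurd hB hA
    · rintro ⟨h1, h2, h3⟩
      refine ⟨_, h3, ?_⟩
      rw [hc _ (by simp [hij.symm]) (mem_insert_self _ _),
        erase_insert (fun h' => h2 (mem_of_mem_erase h')), insert_erase h1]

variable {F : Finset (Finset ℕ)} {n k i j : ℕ}

lemma compression_subset_powersetCard (hij : i ≠ j) (hj : j ∈ Icc 1 n)
    (hF : F ⊆ powersetCard k (Icc 1 n)) :
    compression {j} {i} F ⊆ powersetCard k (Icc 1 n) := by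
  intro A hA
  rcases (mem_compression_singleton hij).1 hA with ⟨h1, -⟩ | ⟨-, h1, h2, h3⟩
  · exact hF h1
  · obtain ⟨h4, h5⟩ := mem_powersetCard.1 (hF h3)
    refine mem_powersetCard.2 ⟨fun x hx => ?_, ?_⟩
    · by_cases hxj : x = j
      · exact hxj ▸ hj
      · exact h4 (mem_insert_of_mem (mem_erase.2 ⟨hxj, hx⟩))
    · rw [card_insert_of_notMem (fun h' => h2 (mem_of_mem_erase h')), card_erase_of_mem h1] at h5
      have : 0 < #A := card_pos.2 ⟨j, h1⟩
      omega

lemma IntersectingFam.compression (hij : i ≠ j) (hF : IntersectingFam F) :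
    IntersectingFam (compression {j} {i} F) := by
  have key : ∀ A B : Finset ℕ, A ∈ F → (i ∈ A → j ∉ A → insert j (A.erase i) ∈ F) →
      j ∈ B → i ∉ B → insert i (B.erase j) ∈ F → (A ∩ B).Nonempty := by
    intro A B hA hA' hjB hiB hB
    by_contra hne
    rw [not_nonempty_iff_eq_empty, ← disjoint_iff_inter_eq_empty, disjoint_left] at hne
    have hjA : j ∉ A := fun h => hne h hjB
    have hiA : i ∈ A := by
      obtain ⟨x, hx⟩ := hF _ hA _ hB
      rw [mem_inter, mem_insert, mem_erase] at hx
      rcases hx with ⟨h1, rfl | h2⟩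
      · exact h1
      · exact absurd h2.2 (hne h1)
    obtain ⟨x, hx⟩ := hF _ (hA' hiA hjA) _ hB
    simp only [mem_inter, mem_insert, mem_erase] at hx
    rcases hx with ⟨rfl | h1, rfl | h2⟩
    · exact hij rfl
    · exact h2.1 rfl
    · exact h1.1 rfl
    · exact hne h1.2 h2.2
  intro A hA B hB
  rcases (mem_compression_singleton hij).1 hA with ⟨hA1, hA2⟩ | ⟨-, hA1, hA2, hA3⟩ <;>
  rcases (mem_compression_singleton hij).1 hB with ⟨hB1, hB2⟩ | ⟨-, hB1, hB2, hB3⟩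
  · exact hF _ hA1 _ hB1
  · exact key A B hA1 hA2 hB1 hB2 hB3
  · rw [inter_comm]
    exact key B A hB1 hB2 hA1 hA2 hA3
  · exact ⟨j, mem_inter.2 ⟨hA1, hB1⟩⟩

lemma card_nonMemberSubfamily_le_compression (hij : i ≠ j) {x : ℕ} (hx : x ≠ j) :
    #(F.nonMemberSubfamily x) ≤ #((compression {j} {i} F).nonMemberSubfamily x) := by
  by_cases hxi : x = i
  · subst hxi
    refine card_le_card fun A hA => ?_
    rw [mem_nonMemberSubfamily] at hA ⊢
    exact ⟨(mem_compression_singleton hij).2 (Or.inl ⟨hA.1, fun h => absurd h hA.2⟩), hA.2⟩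
  · rw [← card_compression {j} {i} (F.nonMemberSubfamily x)]
    refine card_le_card fun A hA => ?_
    rw [mem_compression_singleton hij] at hA
    simp only [mem_nonMemberSubfamily, mem_compression_singleton hij] at hA ⊢
    simp only [mem_insert, mem_erase] at hA
    tauto

lemma nonMemberSubfamily_nonMemberSubfamily_subset_compression (hij : i ≠ j) :
    (F.nonMemberSubfamily i).nonMemberSubfamily j ⊆
      (compression {j} {i} F).nonMemberSubfamily j := by
  intro A hA
  rw [mem_nonMemberSubfamily, mem_nonMemberSubfamily] at hA
  rw [mem_nonMemberSubfamily, mem_compression_singleton hij]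
  exact ⟨Or.inl ⟨hA.1.1, fun h => absurd h hA.1.2⟩, hA.2⟩

/-- Moving elements to the right decreases the total distance to `n`. -/
lemma sum_compression_lt (hij : i < j) (hj : j ≤ n) (hne : compression {j} {i} F ≠ F) :
    ∑ A ∈ compression {j} {i} F, ∑ x ∈ A, (n - x) < ∑ A ∈ F, ∑ x ∈ A, (n - x) := by
  set G := compression {j} {i} F with hG
  have hcard : #G = #F := card_compression _ _ _
  have hGF : (G \ F).Nonempty := by
    rw [sdiff_nonempty]
    exact fun h => hne (eq_of_subset_of_card_le h hcard.ge)
  rw [← sum_inter_add_sum_sdiff G F, ← sum_inter_add_sum_sdiff F G, inter_comm F G]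
  refine Nat.add_lt_add_left ?_ _
  have hmem : ∀ A ∈ G \ F, j ∈ A ∧ i ∉ A ∧ insert i (A.erase j) ∈ F := by
    intro A hA
    obtain ⟨h1, h2⟩ := mem_sdiff.1 hA
    rcases (mem_compression_singleton hij.ne).1 h1 with ⟨h3, -⟩ | ⟨-, h3⟩
    · exact absurd h3 h2
    · exact h3
  have hinj : Set.InjOn (fun A : Finset ℕ => insert i (A.erase j)) (G \ F : Finset (Finset ℕ)) := by
    intro A hA B hB h
    obtain ⟨hA1, hA2, -⟩ := hmem A hA
    obtain ⟨hB1, hB2, -⟩ := hmem B hB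
    have h' := congrArg (fun C => insert j (C.erase i)) h
    simp only [erase_insert (fun h' => hA2 (mem_of_mem_erase h')),
      erase_insert (fun h' => hB2 (mem_of_mem_erase h')), insert_erase hA1, insert_erase hB1] at h'
    exact h'
  calc ∑ A ∈ G \ F, ∑ x ∈ A, (n - x)
      < ∑ A ∈ G \ F, ∑ x ∈ insert i (A.erase j), (n - x) := by
        refine sum_lt_sum_of_nonempty hGF fun A hA => ?_
        obtain ⟨hA1, hA2, -⟩ := hmem A hA
        rw [sum_insert (fun h' => hA2 (mem_of_mem_erase h')), ← add_sum_erase A _ hA1]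
        omega
    _ = ∑ A ∈ (G \ F).image (fun A => insert i (A.erase j)), ∑ x ∈ A, (n - x) :=
        by rw [sum_image hinj]
    _ ≤ ∑ A ∈ F \ G, ∑ x ∈ A, (n - x) := by
        refine sum_le_sum_of_subset fun B hB => ?_
        obtain ⟨A, hA, rfl⟩ := mem_image.1 hB
        obtain ⟨hA1, hA2, hA3⟩ := hmem A hA
        refine mem_sdiff.2 ⟨hA3, fun h => ?_⟩
        rcases (mem_compression_singleton hij.ne).1 h with ⟨-, h3⟩ | ⟨h3, -⟩
        · have := h3 (mem_insert_self _ _) (by simp [hij.ne'])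
          rw [erase_insert (fun h' => hA2 (mem_of_mem_erase h')), insert_erase hA1] at this
          exact (mem_sdiff.1 hA).2 this
        · exact h3 hA3

lemma compression_ne_of_not_mem (hij : i ≠ j) {A : Finset ℕ} (hA : A ∈ F) (hi : i ∈ A) (hj : j ∉ A)
    (h : insert j (A.erase i) ∉ F) : compression {j} {i} F ≠ F := by
  intro heq
  rw [← heq, mem_compression_singleton hij] at hA
  tauto

end Shift

lemma choose_complement_mid (q p : ℕ) : (q + p + 1).choose (p + 1) = (q + p + 1).choose q :=
  Nat.choose_symm_of_eq_add (by ring)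

lemma IntersectingFam.card_bound_of_card_le {q p x : ℕ} {F : Finset (Finset ℕ)}
    (hF : F ⊆ powersetCard (q + 2) (Icc 1 (q + p + 4))) (hint : IntersectingFam F) (hqp : q ≤ p)
    (hx : x ∈ Icc 1 (q + p + 4)) (hγ : #(F.nonMemberSubfamily x) ≤ (q + p + 1).choose q) :
    #(F.nonMemberSubfamily x) * (q + p + 1).choose (q + 1) +
      #(F.memberSubfamily x) * (q + p + 1).choose q ≤
        (q + p + 3).choose (q + 1) * (q + p + 1).choose q := by
  have hX : #((Icc 1 (q + p + 4)).erase x) = q + p + 3 := by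
    rw [card_erase_of_mem hx, Nat.card_Icc]; omega
  have hb : q + p + 3 - (q + 2) = p + 1 := by omega
  have := (hint.crossIntersecting_memberSubfamily x).card_mul_add_card_mul_le
    (m := q + p + 1) (memberSubfamily_subset_powersetCard hF)
    (nonMemberSubfamily_subset_powersetCard hF) (by rw [hX]; omega) (by rw [hX]; omega)
    (by rw [hX, hb, choose_complement_mid]; exact hγ)
  rw [hX, hb, choose_complement_mid] at this
  exact this

lemma IntersectingFam.card_bound_of_le_card {q p x : ℕ} {F : Finset (Finset ℕ)}
    (hF : F ⊆ powersetCard (q + 2) (Icc 1 (q + p + 4))) (hint : IntersectingFam F) (hqp : q ≤ p)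
    (hp : 1 ≤ p) (hx : x ∈ Icc 1 (q + p + 4))
    (hγ : (q + p + 1).choose q ≤ #(F.nonMemberSubfamily x))
    (hγ' : #(F.nonMemberSubfamily x) ≤ (q + p + 2).choose (q + 1)) :
    #(F.nonMemberSubfamily x) * (q + p + 1).choose q +
      ((q + p + 1).choose (q + 1) + #(F.memberSubfamily x)) * (q + p + 1).choose (q + 1) ≤
        (q + p + 3).choose (q + 1) * (q + p + 1).choose (q + 1) +
          (q + p + 1).choose q * (q + p + 1).choose q := by
  have hX : #((Icc 1 (q + p + 4)).erase x) = q + p + 3 := by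
    rw [card_erase_of_mem hx, Nat.card_Icc]; omega
  have h1 : (q + p + 1).choose p = (q + p + 1).choose (q + 1) :=
    Nat.choose_symm_of_eq_add (by ring)
  have h2 : (q + p + 1 + 1).choose (p + 1) = (q + p + 2).choose (q + 1) :=
    Nat.choose_symm_of_eq_add (by ring)
  have := (hint.crossIntersecting_memberSubfamily x).chord_le
    (m := q + p + 1) (ℓ := q) (r := p) (memberSubfamily_subset_powersetCard hF)
    (nonMemberSubfamily_subset_powersetCard hF) (by rw [hX]; omega) hqp (by rw [hX]; omega)
    (by omega) (by rw [choose_complement_mid]; exact hγ) (by rw [h2]; exact hγ')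
  rw [hX, h1, choose_complement_mid] at this
  exact this

/-- Two cross-intersecting families of the same uniformity, neither of which is tiny. -/
lemma CrossIntersecting.card_add_card_le_two_mul {q p : ℕ} {X : Finset ℕ}
    {𝒜 ℬ : Finset (Finset ℕ)} (hX : #X = q + p + 2) (hqp : q + 1 ≤ p)
    (h𝒜 : 𝒜 ⊆ powersetCard (q + 1) X) (hℬ : ℬ ⊆ powersetCard (q + 1) X)
    (h : CrossIntersecting 𝒜 ℬ) (h𝒜0 : 𝒜.Nonempty) (hℬ0 : ℬ.Nonempty)
    (h𝒜d : (q + p).choose (p + 1) ≤ #𝒜) (hℬd : (q + p).choose (p + 1) ≤ #ℬ) :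
    #𝒜 + #ℬ ≤ 2 * (q + p + 1).choose q := by
  have hb : q + p + 2 - (q + 1) = p + 1 := by omega
  have hc2 : 0 < (q + p + 1).choose q := Nat.choose_pos (by omega)
  have hN : (q + p + 2).choose (q + 1) = (q + p + 1).choose q + (q + p + 1).choose (q + 1) :=
    Nat.choose_succ_succ _ _
  have low : ∀ ℬ' ⊆ ℬ, #ℬ' ≤ (q + p + 1).choose q →
      #ℬ' * (q + p + 1).choose (q + 1) + #𝒜 * (q + p + 1).choose q ≤
        (q + p + 2).choose (q + 1) * (q + p + 1).choose q := by
    intro ℬ' hℬ' hc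
    have := CrossIntersecting.card_mul_add_card_mul_le (m := q + p + 1) h𝒜 (hℬ'.trans hℬ)
      (fun A hA B hB => h A hA B (hℬ' hB)) (by rw [hX]; omega) (by rw [hX]; omega)
      (by rw [hX, hb, choose_complement_mid]; exact hc)
    rwa [hX, hb, choose_complement_mid] at this
  wlog hle : #ℬ ≤ (q + p + 1).choose q generalizing 𝒜 ℬ
  · obtain ⟨ℬ', hℬ', hc⟩ := exists_subset_card_eq (not_le.1 hle).le
    have h1 := low ℬ' hℬ' hc.le
    rw [hc, hN] at h1
    have h𝒜c : #𝒜 ≤ (q + p + 1).choose q := by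
      refine Nat.le_of_mul_le_mul_right ?_ hc2
      nlinarith
    have hsymm : CrossIntersecting ℬ 𝒜 := fun A hA B hB => by
      rw [inter_comm]; exact h B hB A hA
    rw [add_comm]
    refine this hℬ h𝒜 hsymm hℬ0 h𝒜0 hℬd h𝒜d (fun 𝒜' h𝒜' hc => ?_) h𝒜c
    have := CrossIntersecting.card_mul_add_card_mul_le (m := q + p + 1) hℬ (h𝒜'.trans h𝒜)
      (fun A hA B hB => hsymm A hA B (h𝒜' hB)) (by rw [hX]; omega) (by rw [hX]; omega)
      (by rw [hX, hb, choose_complement_mid]; exact hc)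
    rwa [hX, hb, choose_complement_mid] at this
  rcases Nat.eq_zero_or_pos q with rfl | hq
  · have h1 := low ℬ subset_rfl hle
    rw [hN] at h1
    have := card_pos.2 hℬ0
    simp only [Nat.choose_zero_right] at *
    have h2 : #ℬ = 1 := by omega
    rw [h2] at h1 ⊢
    omega
  · have h1 : (q + p).choose p = (q + p).choose q := Nat.choose_symm_of_eq_add (by ring)
    have h2 : (q + p + 1).choose (p + 1) = (q + p).choose p + (q + p).choose (p + 1) :=
      Nat.choose_succ_succ _ _
    have h3 : (q + p + 1).choose (q + 1) = (q + p).choose q + (q + p).choose (q + 1) :=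
      Nat.choose_succ_succ _ _
    have h4 := choose_complement_mid q p
    have h5 : 0 < (q + p).choose q := Nat.choose_pos (by omega)
    have := h.chord_le (m := q + p) (ℓ := q) (r := p) h𝒜 hℬ (by rw [hX]; omega) (by omega)
      (by rw [hX]; omega) (by omega) hℬd (by rw [h4]; exact hle)
    rw [hX, hN, h1] at this
    have h6 : #ℬ + ((q + p).choose (q + 1) + #𝒜) ≤
        (q + p + 1).choose q + (q + p + 1).choose (q + 1) + (q + p).choose (p + 1) := by
      refine Nat.le_of_mul_le_mul_right ?_ h5
      linarith
    omega

/-- The gap in the core bound, as a fraction of the largest possible one, for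
`n = q + p + 4` and `k = q + 2`. -/
def gapRatio (q p : ℕ) : ℚ :=
  (q + p + 3) * (q + p + 2) / ((q + p + 4) ^ 2 + 2 * (q + 2) ^ 2)

/-- A bound on intersecting families in which every point is missed often. -/
def coreBound (q p : ℕ) : ℚ :=
  (q + p + 3).choose (q + 1) -
    gapRatio q p * ((q + p + 1).choose (q + 1) - (q + p + 1).choose q)

lemma choose_ratio_left (q p : ℕ) :
    ((q + p).choose (q + 1) : ℚ) * (q + 1) = (q + p).choose q * p := by
  have := Nat.choose_succ_right_eq (q + p) q
  rw [Nat.add_sub_cancel_left] at this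
  exact_mod_cast this

lemma choose_ratio_right (q p : ℕ) :
    ((q + p).choose (p + 1) : ℚ) * (p + 1) = (q + p).choose q * q := by
  have := Nat.choose_succ_right_eq (q + p) p
  rw [Nat.add_sub_cancel, Nat.choose_symm_of_eq_add (show q + p = p + q by ring)] at this
  exact_mod_cast this

lemma choose_left_eq (q p : ℕ) :
    ((q + p + 1).choose (q + 1) : ℚ) = (q + p).choose q + (q + p).choose (q + 1) := by
  exact_mod_cast Nat.choose_succ_succ _ _

lemma choose_mid_eq (q p : ℕ) :
    ((q + p + 1).choose q : ℚ) = (q + p).choose q + (q + p).choose (p + 1) := by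
  rw [← choose_complement_mid, Nat.choose_succ_succ' (q + p) p,
    Nat.choose_symm_of_eq_add (show q + p = p + q by ring)]
  push_cast; rfl

lemma choose_mid_ratio (q p : ℕ) :
    ((q + p + 1).choose (q + 1) : ℚ) * (q + 1) = (q + p + 1).choose q * (p + 1) := by
  have := choose_ratio_left q (p + 1)
  push_cast [← add_assoc] at this
  exact this

lemma choose_top_ratio (q p : ℕ) :
    ((q + p + 3).choose (q + 1) : ℚ) * ((q + 1) * (p + 2)) =
      (q + p + 1).choose q * ((q + p + 3) * (q + p + 2)) := by
  have h1 := Nat.add_one_mul_choose_eq (q + p + 2) q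
  have h2 := Nat.choose_mul_succ_eq (q + p + 1) q
  rw [show q + p + 1 + 1 - q = p + 2 by omega] at h2
  have h1' : ((q + p + 2 + 1 : ℕ) : ℚ) * (q + p + 2).choose q =
    (q + p + 3).choose (q + 1) * (q + 1 : ℕ) := by exact_mod_cast h1
  have h2' : ((q + p + 1).choose q : ℚ) * (q + p + 1 + 1 : ℕ) =
    (q + p + 2).choose q * (p + 2 : ℕ) := by exact_mod_cast h2
  push_cast at h1' h2'
  linear_combination (-(p + 2 : ℚ)) * h1' - (q + p + 3 : ℚ) * h2'

lemma gapRatio_pos (q p : ℕ) : 0 < gapRatio q p := by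
  unfold gapRatio; positivity

lemma gapRatio_lt_one (q p : ℕ) : gapRatio q p < 1 := by
  unfold gapRatio
  rw [div_lt_one (by positivity)]
  have : (0 : ℚ) ≤ q := by positivity
  have : (0 : ℚ) ≤ p := by positivity
  nlinarith

/-- `1 - gapRatio` with its denominator cleared. -/
lemma one_sub_gapRatio_mul (q p : ℕ) :
    (1 - gapRatio q p) * ((q + p + 4) ^ 2 + 2 * (q + 2) ^ 2) =
      2 * (q + 2) ^ 2 + 3 * (q + p + 4) - 2 := by
  unfold gapRatio
  have : ((q : ℚ) + p + 4) ^ 2 + 2 * (q + 2) ^ 2 ≠ 0 := by positivity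
  field_simp
  ring

lemma choose_small_le {q p : ℕ} (hqp : q + 4 ≤ p) :
    ((q + p).choose (p + 1) : ℚ) ≤ (1 - gapRatio q p) *
      ((q + p + 1).choose (q + 1) + (q + p + 1).choose q) := by
  obtain ⟨d, rfl⟩ := Nat.exists_eq_add_of_le hqp
  set p := q + 4 + d with hp
  have hpq : (p : ℚ) = q + 4 + d := by rw [hp]; push_cast; ring
  have hq0 : (0 : ℚ) ≤ q := by positivity
  have hd0 : (0 : ℚ) ≤ d := by positivity
  have hc : (0 : ℚ) ≤ (q + p).choose q := by positivity
  have h1 := choose_ratio_left q p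
  have h2 := choose_ratio_right q p
  have h3 := one_sub_gapRatio_mul q p
  rw [choose_left_eq, choose_mid_eq]
  set a : ℚ := ((q + p).choose q : ℚ)
  have key : (0 : ℚ) ≤ (2 * (q + 2) ^ 2 + 3 * (q + p + 4) - 2) * ((q + p + 1) * (q + p + 2)) -
      q * (q + 1) * ((q + p + 4) ^ 2 + 2 * (q + 2) ^ 2) := by
    rw [hpq]; ring_nf; positivity
  have hD : (0 : ℚ) < ((q + p + 4) ^ 2 + 2 * (q + 2) ^ 2) * ((q + 1) * (p + 1)) := by positivity
  refine le_of_mul_le_mul_right ?_ hD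
  have := mul_nonneg hc key
  linear_combination this
    + (q + 1) * ((q + p + 4) ^ 2 + 2 * (q + 2) ^ 2 : ℚ) * h2
    - (1 - gapRatio q p) * ((q + p + 4) ^ 2 + 2 * (q + 2) ^ 2 : ℚ) * ((p + 1) * h1 + (q + 1) * h2)
    - a * ((q + p + 1) * (q + p + 2) : ℚ) * h3

lemma gapRatio_mul_choose_le {q p : ℕ} (hqp : q + 4 ≤ p) :
    gapRatio q p * ((q + p).choose (p + 1) : ℚ) ≤
      (1 - gapRatio q p) * (q + p + 1).choose (q + 1) := by
  obtain ⟨d, rfl⟩ := Nat.exists_eq_add_of_le hqp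
  set p := q + 4 + d with hp
  have hpq : (p : ℚ) = q + 4 + d := by rw [hp]; push_cast; ring
  have hq0 : (0 : ℚ) ≤ q := by positivity
  have hd0 : (0 : ℚ) ≤ d := by positivity
  have hc : (0 : ℚ) ≤ (q + p).choose q := by positivity
  have h1 := choose_ratio_left q p
  have h2 := choose_ratio_right q p
  have h3 := one_sub_gapRatio_mul q p
  rw [choose_left_eq]
  set a : ℚ := ((q + p).choose q : ℚ)
  have key : (0 : ℚ) ≤ (2 * (q + 2) ^ 2 + 3 * (q + p + 4) - 2) * ((q + p + 1) * (p + 1)) -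
      q * (q + 1) * ((q + p + 3) * (q + p + 2)) := by
    rw [hpq]; ring_nf; positivity
  have hD : (0 : ℚ) < ((q + p + 4) ^ 2 + 2 * (q + 2) ^ 2) * ((q + 1) * (p + 1)) := by positivity
  refine le_of_mul_le_mul_right ?_ hD
  have := mul_nonneg hc key
  linear_combination this
    + (q + 1) * gapRatio q p * ((q + p + 4) ^ 2 + 2 * (q + 2) ^ 2 : ℚ) * h2
    - (1 - gapRatio q p) * ((q + p + 4) ^ 2 + 2 * (q + 2) ^ 2 : ℚ) * ((p + 1) * h1)
    - a * ((q + p + 1) * (p + 1) : ℚ) * h3 - a * (q * (q + 1)) * h3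

lemma choose_mid_lt {q p : ℕ} (hqp : q < p) :
    ((q + p + 1).choose q : ℚ) < (q + p + 1).choose (q + 1) := by
  have h := choose_mid_ratio q p
  have hc : (0 : ℚ) < (q + p + 1).choose q := by
    exact_mod_cast Nat.choose_pos (by omega)
  have hqp' : (q : ℚ) < p := by exact_mod_cast hqp
  refine lt_of_mul_lt_mul_right ?_ (show (0 : ℚ) ≤ q + 1 by positivity)
  rw [h]
  exact mul_lt_mul_of_pos_left (by linarith) hc

lemma choose_top_eq (q p : ℕ) :
    ((q + p + 3).choose (q + 1) : ℚ) =
      (q + p + 2).choose q + ((q + p + 1).choose q + (q + p + 1).choose (q + 1)) := by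
  have h1 := Nat.choose_succ_succ' (q + p + 2) q
  have h2 := Nat.choose_succ_succ' (q + p + 1) q
  rw [h2] at h1
  exact_mod_cast h1

/-- If a point of a large intersecting family is missed rarely, it is missed very rarely. -/
lemma IntersectingFam.card_nonMemberSubfamily_lt {q p x : ℕ} {F : Finset (Finset ℕ)}
    (hF : F ⊆ powersetCard (q + 2) (Icc 1 (q + p + 4))) (hint : IntersectingFam F) (hqp : q < p)
    (hx : x ∈ Icc 1 (q + p + 4)) (hcard : coreBound q p < #F)
    (hγ : #(F.nonMemberSubfamily x) ≤ (q + p + 1).choose q) :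
    (#(F.nonMemberSubfamily x) : ℚ) < gapRatio q p * (q + p + 1).choose q := by
  have h1 := hint.card_bound_of_card_le hF hqp.le hx hγ
  have h2 := card_memberSubfamily_add_card_nonMemberSubfamily x F
  have h3 := choose_mid_lt hqp
  have hc : (0 : ℚ) < (q + p + 1).choose q := by
    exact_mod_cast Nat.choose_pos (by omega)
  unfold coreBound at hcard
  rw [← h2] at hcard
  push_cast at hcard
  have h1' : (#(F.nonMemberSubfamily x) : ℚ) * (q + p + 1).choose (q + 1) +
      #(F.memberSubfamily x) * (q + p + 1).choose q ≤
        (q + p + 3).choose (q + 1) * (q + p + 1).choose q := by exact_mod_cast h1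
  refine lt_of_mul_lt_mul_right ?_ (sub_pos.2 h3).le
  have := mul_lt_mul_of_pos_right hcard hc
  linarith

/-- If a point of a large intersecting family is missed often, it is missed very often. -/
lemma IntersectingFam.lt_card_nonMemberSubfamily {q p x : ℕ} {F : Finset (Finset ℕ)}
    (hF : F ⊆ powersetCard (q + 2) (Icc 1 (q + p + 4))) (hint : IntersectingFam F) (hqp : q < p)
    (hx : x ∈ Icc 1 (q + p + 4)) (hcard : coreBound q p < #F)
    (hγ : (q + p + 1).choose q < #(F.nonMemberSubfamily x)) :
    (q + p + 1).choose q + (1 - gapRatio q p) * (q + p + 1).choose (q + 1) <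
      (#(F.nonMemberSubfamily x) : ℚ) := by
  have h3 := choose_mid_lt hqp
  have hκ := gapRatio_pos q p
  have hc : (0 : ℚ) < (q + p + 1).choose q := by
    exact_mod_cast Nat.choose_pos (by omega)
  have hc1 := hc.trans h3
  by_cases hγ' : #(F.nonMemberSubfamily x) ≤ (q + p + 2).choose (q + 1)
  · have h1 := hint.card_bound_of_le_card hF hqp.le (by omega) hx hγ.le hγ'
    have h2 := card_memberSubfamily_add_card_nonMemberSubfamily x F
    unfold coreBound at hcard
    rw [← h2] at hcard
    push_cast at hcard
    have h1' : (#(F.nonMemberSubfamily x) : ℚ) * (q + p + 1).choose q +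
        ((q + p + 1).choose (q + 1) + #(F.memberSubfamily x)) * (q + p + 1).choose (q + 1) ≤
          (q + p + 3).choose (q + 1) * (q + p + 1).choose (q + 1) +
            (q + p + 1).choose q * (q + p + 1).choose q := by exact_mod_cast h1
    refine lt_of_mul_lt_mul_right ?_ (sub_pos.2 h3).le
    have := mul_lt_mul_of_pos_right hcard hc1
    linarith
  · have h1 : (q + p + 2).choose (q + 1) < #(F.nonMemberSubfamily x) := not_le.1 hγ'
    rw [show (q + p + 2).choose (q + 1) = (q + p + 1).choose q + (q + p + 1).choose (q + 1) from
      Nat.choose_succ_succ' (q + p + 1) q] at h1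
    have h1' : ((q + p + 1).choose q : ℚ) + (q + p + 1).choose (q + 1) <
      #(F.nonMemberSubfamily x) := by exact_mod_cast h1
    have := mul_pos hκ hc1
    linarith

/-- Cross-intersecting families whose uniformities differ by two, the larger of which is not too
big. -/
lemma CrossIntersecting.card_add_card_le {q p : ℕ} {X : Finset ℕ} {𝒜 ℬ : Finset (Finset ℕ)}
    (hX : #X = q + p + 2) (hqp : q + 4 ≤ p) (h𝒜 : 𝒜 ⊆ powersetCard q X)
    (hℬ : ℬ ⊆ powersetCard (q + 2) X) (h : CrossIntersecting 𝒜 ℬ)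
    (hcard : (#ℬ : ℚ) < gapRatio q p * (q + p + 1).choose q) :
    (#𝒜 + #ℬ : ℚ) ≤ (q + p + 2).choose q +
      (1 - gapRatio q p) * ((q + p + 1).choose (q + 1) - (q + p + 1).choose q) := by
  have hlt := choose_mid_lt (show q < p by omega)
  have hκ := gapRatio_lt_one q p
  have hb : q + p + 2 - (q + 2) = p := by omega
  have hsymm : (q + p).choose p = (q + p).choose q := Nat.choose_symm_of_eq_add (by ring)
  have hd2 : 0 < (q + p).choose q := Nat.choose_pos (by omega)
  rcases le_total #ℬ ((q + p).choose q) with hle | hle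
  · have h1 := h.card_mul_add_card_mul_le (m := q + p) h𝒜 hℬ (by rw [hX]; omega)
      (by rw [hX]; omega) (by rw [hX, hb, hsymm]; exact hle)
    rw [hX, hb, hsymm, ← add_mul, add_comm #ℬ] at h1
    have h2 : (#𝒜 + #ℬ : ℚ) ≤ (q + p + 2).choose q := by
      exact_mod_cast Nat.le_of_mul_le_mul_right h1 hd2
    have := mul_nonneg (sub_pos.2 hκ).le (sub_pos.2 hlt).le
    linarith
  · have hle' : (#ℬ : ℚ) ≤ (q + p + 1).choose q := by
      refine hcard.le.trans ?_
      exact mul_le_of_le_one_left (by positivity) hκ.le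
    rcases q with - | q
    · have h1 : (#ℬ : ℚ) < 1 := by
        refine hcard.trans_le ?_
        simpa using hκ.le
      have h2 : #ℬ < 1 := by exact_mod_cast h1
      rw [Nat.choose_zero_right] at hle
      omega
    obtain ⟨p, rfl⟩ : ∃ p', p = p' + 1 := ⟨p - 1, by omega⟩
    have hs1 : (q + 1 + (p + 1) + 1).choose (p + 1) = (q + 1 + (p + 1) + 1).choose (q + 1 + 1) :=
      Nat.choose_symm_of_eq_add (by ring)
    have hs2 : (q + 1 + (p + 1)).choose p = (q + 1 + (p + 1)).choose (q + 1 + 1) :=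
      Nat.choose_symm_of_eq_add (by ring)
    have hs3 : (q + 1 + (p + 1)).choose q = (q + 1 + (p + 1)).choose (p + 1 + 1) :=
      Nat.choose_symm_of_eq_add (by ring)
    have h1 := h.chord_le (m := q + 1 + (p + 1)) (ℓ := q) (r := p) h𝒜 hℬ (by rw [hX]; omega)
      (by omega) (by rw [hX]; omega) (by omega) (by rw [hsymm]; exact hle)
      (by rw [hs1]; exact_mod_cast hle'.trans hlt.le)
    rw [hX, hs2, hs3, hsymm] at h1
    have h2 := gapRatio_mul_choose_le hqp
    have h3 := choose_left_eq (q + 1) (p + 1)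
    have h4 := choose_mid_eq (q + 1) (p + 1)
    have h1' : (#ℬ : ℚ) * (q + 1 + (p + 1)).choose (p + 1 + 1) +
        ((q + 1 + (p + 1)).choose (q + 1) + #𝒜) * (q + 1 + (p + 1)).choose (q + 1 + 1) ≤
          (q + 1 + (p + 1) + 2).choose (q + 1) * (q + 1 + (p + 1)).choose (q + 1 + 1) +
            (q + 1 + (p + 1)).choose (q + 1) * (q + 1 + (p + 1)).choose (p + 1 + 1) := by
      exact_mod_cast h1
    have hd1 : (0 : ℚ) < (q + 1 + (p + 1)).choose (q + 1 + 1) := by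
      exact_mod_cast Nat.choose_pos (by omega)
    rw [h3, h4] at hlt
    rw [h4] at hcard
    rw [h3] at h2
    rw [h3, h4]
    set d1 : ℚ := ((q + 1 + (p + 1)).choose (q + 1 + 1) : ℚ)
    set d2 : ℚ := ((q + 1 + (p + 1)).choose (q + 1) : ℚ)
    set d3 : ℚ := ((q + 1 + (p + 1)).choose (p + 1 + 1) : ℚ)
    set κ := gapRatio (q + 1) (p + 1)
    have h5 : (#ℬ : ℚ) - d2 ≤ (1 - κ) * d1 := by linarith
    have h6 := mul_le_mul_of_nonneg_right h5 (show 0 ≤ d1 - d3 by linarith)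
    refine le_of_mul_le_mul_right ?_ hd1
    linarith

/-- An intersecting family with two points that are missed often, but rarely simultaneously. -/
lemma IntersectingFam.card_le_coreBound {q p i j : ℕ} {F : Finset (Finset ℕ)}
    (hF : F ⊆ powersetCard (q + 2) (Icc 1 (q + p + 4))) (hint : IntersectingFam F)
    (hqp : q + 4 ≤ p) (hi : i ∈ Icc 1 (q + p + 4)) (hj : j ∈ Icc 1 (q + p + 4)) (hij : i ≠ j)
    (hγi : (q + p + 1).choose q + (1 - gapRatio q p) * (q + p + 1).choose (q + 1) <
      (#(F.nonMemberSubfamily i) : ℚ))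
    (hγj : (q + p + 1).choose q + (1 - gapRatio q p) * (q + p + 1).choose (q + 1) <
      (#(F.nonMemberSubfamily j) : ℚ))
    (h0 : (#((F.nonMemberSubfamily i).nonMemberSubfamily j) : ℚ) <
      gapRatio q p * (q + p + 1).choose q) :
    (#F : ℚ) ≤ coreBound q p := by
  have hX : #(((Icc 1 (q + p + 4)).erase i).erase j) = q + p + 2 := by
    rw [card_erase_of_mem (mem_erase.2 ⟨hij.symm, hj⟩), card_erase_of_mem hi, Nat.card_Icc]; omega
  set X := ((Icc 1 (q + p + 4)).erase i).erase j
  set F0 := (F.nonMemberSubfamily i).nonMemberSubfamily j with hF0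
  set Fj := (F.nonMemberSubfamily i).memberSubfamily j with hFj
  set Fi := (F.memberSubfamily i).nonMemberSubfamily j with hFi
  set Fij := (F.memberSubfamily i).memberSubfamily j with hFij
  have hsub0 : F0 ⊆ powersetCard (q + 2) X :=
    nonMemberSubfamily_subset_powersetCard (nonMemberSubfamily_subset_powersetCard hF)
  have hsubj : Fj ⊆ powersetCard (q + 1) X :=
    memberSubfamily_subset_powersetCard (nonMemberSubfamily_subset_powersetCard hF)
  have hsubi : Fi ⊆ powersetCard (q + 1) X :=
    nonMemberSubfamily_subset_powersetCard (memberSubfamily_subset_powersetCard hF)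
  have hsubij : Fij ⊆ powersetCard q X :=
    memberSubfamily_subset_powersetCard (memberSubfamily_subset_powersetCard hF)
  have hc1 : #Fj + #F0 = #(F.nonMemberSubfamily i) :=
    card_memberSubfamily_add_card_nonMemberSubfamily _ _
  have hc2 : #Fij + #Fi = #(F.memberSubfamily i) :=
    card_memberSubfamily_add_card_nonMemberSubfamily _ _
  have hc3 : #(F.memberSubfamily i) + #(F.nonMemberSubfamily i) = #F :=
    card_memberSubfamily_add_card_nonMemberSubfamily _ _
  have hc4 : #Fi + #F0 = #(F.nonMemberSubfamily j) := by
    rw [← card_memberSubfamily_add_card_nonMemberSubfamily i (F.nonMemberSubfamily j)]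
    congr 2
    · ext A
      simp only [hFi, mem_memberSubfamily, mem_nonMemberSubfamily, mem_insert, not_or]
      have := hij.symm
      tauto
    · ext A
      simp only [hF0, mem_nonMemberSubfamily]
      tauto
  have hcross1 : CrossIntersecting Fi Fj := by
    intro A hA B hB
    simp only [hFi, hFj, mem_memberSubfamily, mem_nonMemberSubfamily, mem_insert, not_or]
      at hA hB
    obtain ⟨y, hy⟩ := hint _ hA.1.1 _ hB.1.1
    simp only [mem_inter, mem_insert] at hy
    refine ⟨y, mem_inter.2 ⟨?_, ?_⟩⟩ <;> rcases hy with ⟨rfl | h1, rfl | h2⟩ <;> tauto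
  have hcross2 : CrossIntersecting Fij F0 := by
    intro A hA B hB
    simp only [hFij, hF0, mem_memberSubfamily, mem_nonMemberSubfamily, mem_insert, not_or]
      at hA hB
    obtain ⟨y, hy⟩ := hint _ hA.1.1 _ hB.1.1
    simp only [mem_inter, mem_insert] at hy
    refine ⟨y, mem_inter.2 ⟨?_, ?_⟩⟩ <;> rcases hy with ⟨rfl | rfl | h1, h2⟩ <;> tauto
  have hb1 := hcross2.card_add_card_le hX hqp hsubij hsub0 h0
  have hsmall := choose_small_le hqp
  have hpos := mul_pos (sub_pos.2 (gapRatio_lt_one q p))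
    (show (0 : ℚ) < (q + p + 1).choose (q + 1) + (q + p + 1).choose q by
      have : (0 : ℚ) < (q + p + 1).choose q := by exact_mod_cast Nat.choose_pos (by omega)
      positivity)
  have hc1' : (#Fj + #F0 : ℚ) = #(F.nonMemberSubfamily i) := by exact_mod_cast hc1
  have hc4' : (#Fi + #F0 : ℚ) = #(F.nonMemberSubfamily j) := by exact_mod_cast hc4
  have hj0 : (1 - gapRatio q p) * ((q + p + 1).choose (q + 1) + (q + p + 1).choose q) <
    (#Fj : ℚ) := by linarith
  have hi0 : (1 - gapRatio q p) * ((q + p + 1).choose (q + 1) + (q + p + 1).choose q) <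
    (#Fi : ℚ) := by linarith
  have hb2 := hcross1.card_add_card_le_two_mul hX (by omega) hsubi hsubj
    (card_pos.1 (by exact_mod_cast hpos.trans hi0)) (card_pos.1 (by exact_mod_cast hpos.trans hj0))
    (by exact_mod_cast hsmall.trans hi0.le) (by exact_mod_cast hsmall.trans hj0.le)
  have hb2' : (#Fi + #Fj : ℚ) ≤ 2 * (q + p + 1).choose q := by exact_mod_cast hb2
  have hsum : (#F : ℚ) = #Fij + #F0 + (#Fi + #Fj) := by
    exact_mod_cast (by omega : #F = #Fij + #F0 + (#Fi + #Fj))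
  rw [hsum, coreBound, choose_top_eq]
  linarith

lemma IsRightShifted.card_le_coreBound {q p : ℕ} {F : Finset (Finset ℕ)}
    (hs : IsRightShifted (q + p + 4) F)
    (hF : F ⊆ powersetCard (q + 2) (Icc 1 (q + p + 4))) (hint : IntersectingFam F)
    (hqp : q < p) (hγ : (q + p + 1).choose q < #(F.nonMemberSubfamily (q + p + 4))) :
    (#F : ℚ) ≤ coreBound q p := by
  have h1 := hs.card_bound hF hint (by omega) (by omega)
  rw [show q + p + 4 - 1 - (q + 2) = p + 1 by omega, show q + 2 - 1 = q + 1 by omega,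
    show q + p + 4 - 1 = q + p + 3 by omega] at h1
  have h2 := card_memberSubfamily_add_card_nonMemberSubfamily (q + p + 4) F
  have h1' : ((p : ℚ) + 1) * #(F.nonMemberSubfamily (q + p + 4)) +
      (q + 1) * #(F.memberSubfamily (q + p + 4)) ≤ (q + 1) * (q + p + 3).choose (q + 1) := by
    exact_mod_cast h1
  have h2' : (#(F.memberSubfamily (q + p + 4)) + #(F.nonMemberSubfamily (q + p + 4)) : ℚ) = #F := by
    exact_mod_cast h2
  have hγ' : ((q + p + 1).choose q : ℚ) < #(F.nonMemberSubfamily (q + p + 4)) := by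
    exact_mod_cast hγ
  have hqp' : (q : ℚ) < p := by exact_mod_cast hqp
  have h3 := choose_mid_ratio q p
  have h4 := mul_lt_mul_of_pos_left hγ' (sub_pos.2 hqp')
  have h5 := mul_nonneg (sub_pos.2 (gapRatio_lt_one q p)).le (sub_pos.2 (choose_mid_lt hqp)).le
  have h6 : (#F : ℚ) ≤ (q + p + 3).choose (q + 1) -
      ((q + p + 1).choose (q + 1) - (q + p + 1).choose q) := by
    refine le_of_mul_le_mul_left ?_ (show (0 : ℚ) < q + 1 by positivity)
    rw [← h2']
    linarith
  unfold coreBound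
  linarith

/-- An intersecting family in which every point is missed often is small. -/
theorem IntersectingFam.card_le_coreBound_of_forall_lt {q p : ℕ} {F : Finset (Finset ℕ)}
    (hF : F ⊆ powersetCard (q + 2) (Icc 1 (q + p + 4))) (hint : IntersectingFam F)
    (hqp : q + 4 ≤ p)
    (hγ : ∀ x ∈ Icc 1 (q + p + 4), (q + p + 1).choose q < #(F.nonMemberSubfamily x)) :
    (#F : ℚ) ≤ coreBound q p := by
  by_contra! hcard
  induction hw : ∑ A ∈ F, ∑ x ∈ A, (q + p + 4 - x) using Nat.strong_induction_on
    generalizing F with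
  | _ w ih =>
    subst hw
    by_cases hs : IsRightShifted (q + p + 4) F
    · exact hcard.not_ge (hs.card_le_coreBound hF hint (by omega)
        (hγ _ (mem_Icc.2 ⟨by omega, le_rfl⟩)))
    simp only [IsRightShifted] at hs
    push Not at hs
    obtain ⟨A, hA, i, hi, j, hj, hij, hjA, hnew⟩ := hs
    have hne := compression_ne_of_not_mem hij.ne hA hi hjA hnew
    have hiX : i ∈ Icc 1 (q + p + 4) := (mem_powersetCard.1 (hF hA)).1 hi
    have hG := compression_subset_powersetCard (i := i) hij.ne hj hF
    have hGint := IntersectingFam.compression (j := j) hij.ne hint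
    have hGcard : coreBound q p < #(UV.compression {j} {i} F) := by
      rwa [UV.card_compression]
    by_cases hGj : (q + p + 1).choose q < #((UV.compression {j} {i} F).nonMemberSubfamily j)
    · refine ih _ (sum_compression_lt hij (mem_Icc.1 hj).2 hne) hG hGint (fun x hx => ?_)
        hGcard rfl
      by_cases hxj : x = j
      · rwa [hxj]
      · exact (hγ x hx).trans_le (card_nonMemberSubfamily_le_compression hij.ne hxj)
    · have h0 := hGint.card_nonMemberSubfamily_lt hG (by omega) hj hGcard (not_lt.1 hGj)
      have h1 := card_le_card (nonMemberSubfamily_nonMemberSubfamily_subset_compression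
        (F := F) hij.ne)
      refine hcard.not_ge (hint.card_le_coreBound hF hqp hiX hj hij.ne
        (hint.lt_card_nonMemberSubfamily hF (by omega) hiX hcard (hγ i hiX))
        (hint.lt_card_nonMemberSubfamily hF (by omega) hj hcard (hγ j hj)) (lt_of_le_of_lt ?_ h0))
      exact_mod_cast h1

lemma sum_tDeg (F : Finset (Finset ℕ)) (X : Finset ℕ) (t : ℕ) :
    ∑ S ∈ powersetCard t X, tDeg F S = ∑ A ∈ F, (#(A ∩ X)).choose t := by
  simp_rw [tDeg, card_filter]
  rw [sum_comm]
  refine sum_congr rfl fun A _ => ?_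
  rw [← card_filter, ← card_powersetCard]
  congr 1
  ext S
  simp only [mem_filter, mem_powersetCard, subset_inter_iff]
  tauto

lemma sum_tDeg_powersetCard {n k : ℕ} {F : Finset (Finset ℕ)}
    (hF : F ⊆ powersetCard k (Icc 1 n)) (t : ℕ) :
    ∑ S ∈ powersetCard t (Icc 1 n), tDeg F S = #F * k.choose t := by
  rw [sum_tDeg]
  refine sum_const_nat fun A hA => ?_
  obtain ⟨h1, h2⟩ := mem_powersetCard.1 (hF hA)
  rw [inter_eq_left.2 h1, h2]

lemma sum_tDeg_powersetCard_erase {n k : ℕ} {F : Finset (Finset ℕ)}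
    (hF : F ⊆ powersetCard k (Icc 1 n)) (t x : ℕ) :
    ∑ S ∈ powersetCard t ((Icc 1 n).erase x), tDeg F S =
      #(F.memberSubfamily x) * (k - 1).choose t + #(F.nonMemberSubfamily x) * k.choose t := by
  have h : #(F.memberSubfamily x) = #{A ∈ F | x ∈ A} := by
    have h1 := card_memberSubfamily_add_card_nonMemberSubfamily x F
    have h2 := card_filter_add_card_filter_not (s := F) (fun A => x ∈ A)
    rw [nonMemberSubfamily] at h1
    omega
  rw [sum_tDeg, h, nonMemberSubfamily, ← sum_filter_add_sum_filter_not F (fun A => x ∈ A)]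
  congr 1
  · refine sum_const_nat fun A hA => ?_
    obtain ⟨hA, hx⟩ := mem_filter.1 hA
    obtain ⟨h1, h2⟩ := mem_powersetCard.1 (hF hA)
    rw [inter_erase, inter_eq_left.2 h1, card_erase_of_mem hx, h2]
  · refine sum_const_nat fun A hA => ?_
    obtain ⟨hA, hx⟩ := mem_filter.1 hA
    obtain ⟨h1, h2⟩ := mem_powersetCard.1 (hF hA)
    rw [inter_erase, inter_eq_left.2 h1, erase_eq_of_notMem hx, h2]

lemma choose_mul_choose_sub_one {n k t : ℕ} (htk : t < k) (hkn : k ≤ n) :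
    (n - 1).choose t * (n - t - 1).choose (k - t - 1) =
      (n - 1).choose (k - 1) * (k - 1).choose t := by
  have := Nat.choose_mul (n := n - 1) (k := k - 1) (s := t) (by omega)
  rw [this, show n - 1 - t = n - t - 1 by omega, show k - 1 - t = k - t - 1 by omega]

lemma choose_mul_sub_eq_mul_choose_sub_one {k t : ℕ} (htk : t < k) :
    (k.choose t : ℚ) * (k - t) = k * (k - 1).choose t := by
  obtain ⟨k, rfl⟩ : ∃ k', k = k' + 1 := ⟨k - 1, by omega⟩
  have := Nat.choose_mul_succ_eq k t
  rw [Nat.add_sub_cancel]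
  have h : ((k + 1 - t : ℕ) : ℚ) = (k + 1 : ℕ) - t := Nat.cast_sub (by omega)
  rw [← h, mul_comm ((k + 1 : ℕ) : ℚ)]
  exact_mod_cast this.symm

/-- If some point is missed rarely, some `t`-set avoiding it has small degree. -/
lemma exists_tDeg_le_of_weighted_bound {n k t x : ℕ} {F : Finset (Finset ℕ)}
    (hF : F ⊆ powersetCard k (Icc 1 n)) (hk : 2 ≤ k) (htk : t < k) (hkn : k ≤ n)
    (hx : x ∈ Icc 1 n) (hnk : (k * (k - 1) : ℚ) ≤ (n - k - 1) * (k - t))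
    (h : ((n - k - 1) * #(F.nonMemberSubfamily x) + (k - 1) * #(F.memberSubfamily x) : ℚ) ≤
      (k - 1) * (n - 1).choose (k - 1)) :
    ∃ S ∈ powersetCard t (Icc 1 n), tDeg F S ≤ (n - t - 1).choose (k - t - 1) := by
  by_contra! hcon
  have hne : (powersetCard t ((Icc 1 n).erase x)).Nonempty := by
    rw [powersetCard_nonempty, card_erase_of_mem hx, Nat.card_Icc]; omega
  have hsum := sum_lt_sum_of_nonempty hne
    (fun S hS => hcon S (powersetCard_mono (erase_subset _ _) hS))
  rw [sum_const, smul_eq_mul, card_powersetCard, card_erase_of_mem hx, Nat.card_Icc,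
    Nat.add_sub_cancel, choose_mul_choose_sub_one htk hkn, sum_tDeg_powersetCard_erase hF] at hsum
  have hsum' : ((n - 1).choose (k - 1) * (k - 1).choose t : ℚ) <
      #(F.memberSubfamily x) * (k - 1).choose t + #(F.nonMemberSubfamily x) * k.choose t := by
    exact_mod_cast hsum
  have hch := choose_mul_sub_eq_mul_choose_sub_one htk
  have htk' : (t : ℚ) < k := by exact_mod_cast htk
  have hk' : (2 : ℚ) ≤ k := by exact_mod_cast hk
  have ha : (0 : ℚ) < (k - 1).choose t := by exact_mod_cast Nat.choose_pos (by omega)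
  set a : ℚ := ((k - 1).choose t : ℚ)
  set γ : ℚ := (#(F.nonMemberSubfamily x) : ℚ) with hγ
  have hγ0 : 0 ≤ γ := by positivity
  have h1 : (((n - 1).choose (k - 1) : ℚ) * (k - t)) * a <
      (#(F.memberSubfamily x) * (k - t) + γ * k) * a := by
    have := mul_lt_mul_of_pos_right hsum' (sub_pos.2 htk')
    linear_combination this + γ * hch
  have h2 := lt_of_mul_lt_mul_right h1 ha.le
  have h3 := mul_lt_mul_of_pos_right h2 (show (0 : ℚ) < k - 1 by linarith)
  have h4 := mul_le_mul_of_nonneg_right h (sub_pos.2 htk').le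
  have h5 := mul_le_mul_of_nonneg_left hnk hγ0
  linarith

/-- Averaging over all `t`-sets. -/
lemma exists_tDeg_le_of_card_bound {n k t : ℕ} {F : Finset (Finset ℕ)}
    (hF : F ⊆ powersetCard k (Icc 1 n)) (htk : t < k) (hkn : k ≤ n)
    (h : (k * (n - t) * #F : ℚ) ≤ n * (k - t) * (n - 1).choose (k - 1)) :
    ∃ S ∈ powersetCard t (Icc 1 n), tDeg F S ≤ (n - t - 1).choose (k - t - 1) := by
  by_contra! hcon
  have hne : (powersetCard t (Icc 1 n)).Nonempty := by
    rw [powersetCard_nonempty, Nat.card_Icc]; omega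
  have hsum := sum_lt_sum_of_nonempty hne hcon
  rw [sum_const, smul_eq_mul, card_powersetCard, Nat.card_Icc,
    Nat.add_sub_cancel, sum_tDeg_powersetCard hF] at hsum
  have hsum' : (n.choose t * (n - t - 1).choose (k - t - 1) : ℚ) < #F * k.choose t := by
    exact_mod_cast hsum
  have hprod : ((n - 1).choose t * (n - t - 1).choose (k - t - 1) : ℚ) =
      (n - 1).choose (k - 1) * (k - 1).choose t := by
    exact_mod_cast choose_mul_choose_sub_one htk hkn
  have hchk := choose_mul_sub_eq_mul_choose_sub_one htk
  have hchn := choose_mul_sub_eq_mul_choose_sub_one (htk.trans_le hkn)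
  have htk' : (t : ℚ) < k := by exact_mod_cast htk
  have htn' : (t : ℚ) < n := by exact_mod_cast htk.trans_le hkn
  have ha : (0 : ℚ) < (k - 1).choose t := by exact_mod_cast Nat.choose_pos (by omega)
  have h1 : (n * (k - t) * (n - 1).choose (k - 1) : ℚ) * (k - 1).choose t <
      (k * (n - t) * #F) * (k - 1).choose t := by
    have := mul_lt_mul_of_pos_right hsum' (mul_pos (sub_pos.2 htk') (sub_pos.2 htn'))
    linear_combination this - n * (k - t : ℚ) * hprod
      - ((n - t - 1).choose (k - t - 1) : ℚ) * (k - t) * hchn + (#F : ℚ) * (n - t) * hchk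
  exact (lt_of_mul_lt_mul_right h1 ha.le).not_ge h

/-- The core bound is small enough for averaging over all `t`-sets. -/
lemma mul_coreBound_le {q p t : ℕ} (hqp : q < p)
    (h : (t : ℚ) * (q + p + 4 + (q + 2)) ≤ (q + 2) * (p - q)) :
    ((q + 2) * (q + p + 4 - t) * coreBound q p : ℚ) ≤
      (q + p + 4) * (q + 2 - t) * (q + p + 3).choose (q + 1) := by
  have h1 := choose_mid_ratio q p
  have h2 := choose_top_ratio q p
  have h3 := choose_mid_lt hqp
  have hqp' : (q : ℚ) < p := by exact_mod_cast hqp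
  have hκ : gapRatio q p * ((q + p + 4) ^ 2 + 2 * (q + 2) ^ 2) =
      (q + p + 3) * (q + p + 2) := by
    linear_combination -one_sub_gapRatio_mul q p
  unfold coreBound
  set C : ℚ := ((q + p + 3).choose (q + 1) : ℚ)
  set κ := gapRatio q p
  set g : ℚ := ((q + p + 1).choose (q + 1) : ℚ) - (q + p + 1).choose q with hg
  have hg0 : 0 < g := sub_pos.2 h3
  have h4 : C * (p + 2) * (p - q) = g * ((q + p + 3) * (q + p + 2)) := by
    refine mul_right_cancel₀ (show (q : ℚ) + 1 ≠ 0 by positivity) ?_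
    rw [hg]
    linear_combination (p - q : ℚ) * h2 - ((q + p + 3) * (q + p + 2) : ℚ) * h1
  have h5 : (t : ℚ) * ((q + p + 4) ^ 2 + 2 * (q + 2) ^ 2) ≤
      (q + 2) * (q + p + 4 - t) * (p - q) := by
    linear_combination (q + p + 4 : ℚ) * h
  have hpos : 0 < g * ((q + p + 3) * (q + p + 2) : ℚ) := by positivity
  have h6 : C * t * (p + 2) ≤ (q + 2) * (q + p + 4 - t) * κ * g := by
    refine le_of_mul_le_mul_right ?_ (mul_pos (sub_pos.2 hqp')
      (show (0 : ℚ) < (q + p + 4) ^ 2 + 2 * (q + 2) ^ 2 by positivity))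
    have := mul_le_mul_of_nonneg_right h5 hpos.le
    linear_combination this + (t : ℚ) * ((q + p + 4) ^ 2 + 2 * (q + 2) ^ 2) * h4
      - (q + 2) * (q + p + 4 - t) * (p - q) * g * hκ
  linarith

/-- the `t`-degree version of the Erdős–Ko–Rado theorem. -/
theorem statement15 (n k t : ℕ) (ht : 1 ≤ t) (htk : t < k)
    (hn : 2 * (k : ℚ) + 3 * (t : ℚ) * (k : ℚ) / ((k : ℚ) - (t : ℚ)) ≤ (n : ℚ))
    (F : Finset (Finset ℕ)) (hF : F ⊆ (Finset.Icc 1 n).powersetCard k)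
    (hint : IntersectingFam F) :
    ∃ S ∈ (Finset.Icc 1 n).powersetCard t,
      tDeg F S ≤ Nat.choose (n - t - 1) (k - t - 1) := by
  have ht' : (1 : ℚ) ≤ t := by exact_mod_cast ht
  have htk' : (0 : ℚ) < k - t := sub_pos.2 (by exact_mod_cast htk)
  have hmul : (3 * t * k : ℚ) ≤ (n - 2 * k) * (k - t) := by
    rw [← div_le_iff₀ htk']; linarith
  have hnk : 2 * k + 4 ≤ n := by
    have h1 : (3 : ℚ) < n - 2 * k := by
      refine lt_of_mul_lt_mul_right ?_ htk'.le
      nlinarith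
    have h2 : ((2 * k + 3 : ℕ) : ℚ) < n := by push_cast; linarith
    have h3 : 2 * k + 3 < n := by exact_mod_cast h2
    omega
  obtain ⟨q, rfl⟩ : ∃ q, k = q + 2 := ⟨k - 2, by omega⟩
  obtain ⟨p, rfl⟩ : ∃ p, n = q + p + 4 := ⟨n - (q + 4), by omega⟩
  have hqp : q + 4 ≤ p := by omega
  push_cast at hmul htk'
  by_cases hγ : ∀ x ∈ Icc 1 (q + p + 4),
      (q + p + 1).choose q < #(F.nonMemberSubfamily x)
  · refine exists_tDeg_le_of_card_bound hF htk (by omega) ?_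
    have h1 := hint.card_le_coreBound_of_forall_lt hF hqp hγ
    have h2 := mul_coreBound_le (t := t) (show q < p by omega) (by linarith)
    push_cast
    refine le_trans (mul_le_mul_of_nonneg_left h1 (mul_nonneg (by positivity) ?_)) h2
    have : (0 : ℚ) ≤ p := by positivity
    linarith
  · push Not at hγ
    obtain ⟨x, hx, hγx⟩ := hγ
    have h1 := hint.card_bound_of_card_le hF (by omega) hx hγx
    have h1' : (#(F.nonMemberSubfamily x) : ℚ) * (q + p + 1).choose (q + 1) +
        #(F.memberSubfamily x) * (q + p + 1).choose q ≤
          (q + p + 3).choose (q + 1) * (q + p + 1).choose q := by exact_mod_cast h1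
    have h2 := choose_mid_ratio q p
    have hc : (0 : ℚ) < (q + p + 1).choose q := by
      exact_mod_cast Nat.choose_pos (by omega)
    refine exists_tDeg_le_of_weighted_bound hF (by omega) htk (by omega) hx ?_ ?_
    · push_cast
      have : (0 : ℚ) ≤ q * t := by positivity
      linarith
    · rw [show q + p + 4 - 1 = q + p + 3 by omega, show q + 2 - 1 = q + 1 by omega]
      push_cast
      refine le_of_mul_le_mul_right ?_ hc
      have := mul_le_mul_of_nonneg_right h1' (show (0 : ℚ) ≤ q + 1 by positivity)
      linear_combination this - (#(F.nonMemberSubfamily x) : ℚ) * h2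
end

section
/- Let n, s, k, t be positive integers with n ≥ 2k², and suppose k ≥ 5st, or k ≥ 3s in the case t = 1. Then every family F of k-element subsets of [n] with matching number ν(F) ≤ s satisfies δ_t(F) ≤ C(n−t, k−t) − C(n−s−t, k−t), with equality only if F is isomorphic to A_0(n,k,s). -/
open Finset

theorem exists_perm_map_eq {α : Type*} [Fintype α] [DecidableEq α] {C D : Finset α}
    (h : #C = #D) : ∃ τ : Equiv.Perm α, C.map τ.toEmbedding = D := by
  refine ⟨(Finset.equivOfCardEq h).extendSubtype, ?_⟩
  refine Finset.eq_of_subset_of_card_le ?_ (by simp [h])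
  intro x hx
  obtain ⟨y, hy, rfl⟩ := Finset.mem_map.1 hx
  exact Equiv.extendSubtype_mem _ y hy

theorem choose_mul_sum_perm {α : Type*} [Fintype α] [DecidableEq α] (g : Finset α → ℕ)
    (D : Finset α) :
    (Fintype.card α).choose #D * ∑ σ : Equiv.Perm α, g (D.map σ.toEmbedding) =
      Fintype.card (Equiv.Perm α) * ∑ C ∈ (univ : Finset α).powersetCard #D, g C := by
  have h1 : ∀ σ : Equiv.Perm α, ∑ C ∈ (univ : Finset α).powersetCard #D, g (C.map σ.toEmbedding)
      = ∑ C ∈ (univ : Finset α).powersetCard #D, g C := by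
    intro σ
    refine Finset.sum_nbij' (fun C => C.map σ.toEmbedding) (fun C => C.map σ.symm.toEmbedding)
      ?_ ?_ ?_ ?_ ?_ <;> simp +contextual [mem_powersetCard, Finset.map_map]
  have h2 : ∀ C ∈ (univ : Finset α).powersetCard #D,
      ∑ σ : Equiv.Perm α, g (C.map σ.toEmbedding) = ∑ σ : Equiv.Perm α, g (D.map σ.toEmbedding) := by
    intro C hC
    obtain ⟨τ, rfl⟩ := exists_perm_map_eq (mem_powersetCard.1 hC).2.symm
    refine Fintype.sum_equiv (Equiv.mulRight τ) _ _ fun σ => ?_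
    congr 1
    ext x
    simp
    rfl
  have h3 := Finset.sum_comm (s := (univ : Finset α).powersetCard #D)
    (t := (univ : Finset (Equiv.Perm α))) (f := fun C σ => g (C.map σ.toEmbedding))
  rw [Finset.sum_congr rfl h2, Finset.sum_congr rfl fun σ _ => h1 σ] at h3
  simpa [card_powersetCard] using h3

theorem exists_pairwise_disjoint_subsets {α : Type*} [DecidableEq α] (l : ℕ) :
    ∀ (r : ℕ) (V : Finset α), r * l ≤ #V →
    ∃ D : Fin r → Finset α, (∀ i, D i ⊆ V ∧ #(D i) = l) ∧
      Pairwise (Function.onFun Disjoint D) := by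
  intro r
  induction r with
  | zero => exact fun V _ => ⟨Fin.elim0, fun i => i.elim0, fun i => i.elim0⟩
  | succ r ih =>
    intro V hV
    obtain ⟨B, hB, hBl⟩ := exists_subset_card_eq (s := V) (n := l) (by nlinarith)
    obtain ⟨D, hD, hd⟩ := ih (V \ B) (by rw [card_sdiff_of_subset hB, hBl]; lia)
    refine ⟨Fin.cons B D, fun i => ?_, fun i j hij => ?_⟩
    · refine Fin.cases ⟨hB, hBl⟩ (fun i => ?_) i
      exact ⟨(hD i).1.trans sdiff_subset, (hD i).2⟩
    · have hb : ∀ i, Disjoint (D i) B := fun i =>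
        Finset.disjoint_of_subset_left (hD i).1 sdiff_disjoint
      induction i using Fin.cases with
      | zero =>
        induction j using Fin.cases with
        | zero => exact absurd rfl hij
        | succ j => exact (hb j).symm
      | succ i =>
        induction j using Fin.cases with
        | zero => exact hb i
        | succ j => exact hd fun h => hij (congrArg Fin.succ h)

theorem mul_sum_powersetCard_le_univ {α : Type*} [Fintype α] [DecidableEq α] {l r X : ℕ}
    (h : r * l ≤ Fintype.card α) (g : Finset α → ℕ)
    (hg : ∀ D : Fin r → Finset α, (∀ i, #(D i) = l) →
      Pairwise (Function.onFun Disjoint D) → ∑ i, g (D i) ≤ X) :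
    r * ∑ C ∈ (univ : Finset α).powersetCard l, g C ≤ X * (Fintype.card α).choose l := by
  obtain ⟨D, hD, hd⟩ := exists_pairwise_disjoint_subsets l r (univ : Finset α) (by simpa using h)
  have h1 : ∑ σ : Equiv.Perm α, ∑ i, g ((D i).map σ.toEmbedding) ≤
      ∑ _σ : Equiv.Perm α, X := by
    refine Finset.sum_le_sum fun σ _ => hg (fun i => (D i).map σ.toEmbedding) ?_ ?_
    · intro i; simp [(hD i).2]
    · intro i j hij
      exact (Finset.disjoint_map _).2 (hd hij)
  rw [Finset.sum_comm] at h1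
  have h2 : ∀ i, (Fintype.card α).choose l * ∑ σ : Equiv.Perm α, g ((D i).map σ.toEmbedding) =
      Fintype.card (Equiv.Perm α) * ∑ C ∈ (univ : Finset α).powersetCard l, g C := by
    intro i
    have := choose_mul_sum_perm g (D i)
    rwa [(hD i).2] at this
  have h3 := Nat.mul_le_mul_left ((Fintype.card α).choose l) h1
  rw [Finset.mul_sum, Finset.sum_congr rfl fun i _ => h2 i] at h3
  simp only [sum_const, card_univ, Fintype.card_fin, smul_eq_mul] at h3
  refine Nat.le_of_mul_le_mul_left ?_ (Fintype.card_pos (α := Equiv.Perm α))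
  linarith

/-- Averaging a weight over all systems of `r` pairwise disjoint `l`-subsets of `V`. -/
theorem mul_sum_powersetCard_le {α : Type*} [DecidableEq α] {V : Finset α} {l r X : ℕ}
    (h : r * l ≤ #V) (g : Finset α → ℕ)
    (hg : ∀ D : Fin r → Finset α, (∀ i, D i ⊆ V ∧ #(D i) = l) →
      Pairwise (Function.onFun Disjoint D) → ∑ i, g (D i) ≤ X) :
    r * ∑ C ∈ V.powersetCard l, g C ≤ X * (#V).choose l := by
  have := mul_sum_powersetCard_le_univ (α := V) (l := l) (r := r) (X := X) (by simpa using h)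
    (fun C => g (C.map (Function.Embedding.subtype _))) ?_
  · rw [Fintype.card_coe] at this
    convert this using 2
    conv_lhs => rw [← Finset.attach_map_val (s := V), Finset.powersetCard_map, Finset.sum_map]
    rfl
  · intro D hD hd
    refine hg (fun i => (D i).map (Function.Embedding.subtype _)) ?_ ?_
    · intro i
      refine ⟨fun x hx => ?_, by simp [hD i]⟩
      obtain ⟨y, _, rfl⟩ := mem_map.1 hx
      exact y.2
    · intro i j hij
      exact (Finset.disjoint_map _).2 (hd hij)

theorem sum_le_mul_of_no_injective {s r : ℕ} (hr : s + 1 ≤ r) (μ : Fin r → ℕ)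
    (h : ¬ ∃ e : Fin (s + 1) → Fin r, Function.Injective e ∧
      ∀ j : Fin (s + 1), (j : ℕ) + 1 ≤ μ (e j)) :
    ∑ i, (min (μ i) s + if s + 1 ≤ μ i then r - s else 0) ≤ s * r := by
  have h1 : ¬ ∃ e : Fin (s + 1) → Fin r, Function.Injective e ∧
      ∀ j : Fin (s + 1), e j ∈ (univ.filter fun i => (j : ℕ) + 1 ≤ μ i) := by simpa using h
  rw [← Finset.all_card_le_biUnion_card_iff_exists_injective] at h1
  push Not at h1
  obtain ⟨J, hJ⟩ := h1
  have hne : J.Nonempty := by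
    by_contra h0
    rw [not_nonempty_iff_eq_empty.1 h0] at hJ
    simp at hJ
  set j := J.min' hne with hj
  set m := #(univ.filter fun i => (j : ℕ) + 1 ≤ μ i) with hm
  have hm1 : m ≤ s - j := by
    have h2 : m ≤ #(J.biUnion fun j => univ.filter fun i => (j : ℕ) + 1 ≤ μ i) :=
      card_le_card (subset_biUnion_of_mem
        (fun j : Fin (s + 1) => univ.filter fun i => (j : ℕ) + 1 ≤ μ i) (J.min'_mem hne))
    have h3 : #J ≤ #(Finset.Ici j) := card_le_card fun x hx => by
      simpa using J.min'_le x hx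
    rw [Fin.card_Ici] at h3
    lia
  have hjs : (j : ℕ) ≤ s := by lia
  calc ∑ i, (min (μ i) s + if s + 1 ≤ μ i then r - s else 0)
      ≤ ∑ i, ((j : ℕ) + if (j : ℕ) + 1 ≤ μ i then r - j else 0) := by
        refine Finset.sum_le_sum fun i _ => ?_
        split_ifs <;> lia
    _ = r * j + m * (r - j) := by
        rw [sum_add_distrib, ← sum_filter, sum_const, sum_const, smul_eq_mul, smul_eq_mul]
        simp [hm]
    _ ≤ r * j + (s - j) * (r - j) := by gcongr
    _ ≤ s * r := by
        obtain ⟨a, ha⟩ := Nat.exists_eq_add_of_le hjs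
        obtain ⟨b, hb⟩ := Nat.exists_eq_add_of_le (show (j : ℕ) ≤ r by lia)
        rw [show s - (j : ℕ) = a by lia, show r - (j : ℕ) = b by lia]
        have : a + 1 ≤ b := by lia
        generalize (j : ℕ) = j at *
        subst ha hb
        nlinarith

/-- Among any `s + 1` pairwise disjoint `l`-subsets of `V`, indexed by `0, …, s`,
some `j`-th set has weight at most `j`. -/
def NoClimb (V : Finset ℕ) (l s : ℕ) (μ : Finset ℕ → ℕ) : Prop :=
  ∀ D : Fin (s + 1) → Finset ℕ, (∀ i, D i ⊆ V ∧ #(D i) = l) →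
    Pairwise (Function.onFun Disjoint D) → ∃ j, μ (D j) ≤ j

theorem NoClimb.sum_le {V : Finset ℕ} {l s r : ℕ} {μ : Finset ℕ → ℕ} (h : NoClimb V l s μ)
    (hr : s + 1 ≤ r) (hV : r * l ≤ #V) :
    ∑ C ∈ V.powersetCard l, (min (μ C) s + if s + 1 ≤ μ C then r - s else 0)
      ≤ s * (#V).choose l := by
  have := mul_sum_powersetCard_le hV
    (fun C => min (μ C) s + if s + 1 ≤ μ C then r - s else 0) (X := s * r) ?_
  · refine Nat.le_of_mul_le_mul_left ?_ (show 0 < r by lia)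
    linarith
  · intro D hD hd
    refine sum_le_mul_of_no_injective hr (fun i => μ (D i)) ?_
    rintro ⟨e, he, hμ⟩
    obtain ⟨j, hj⟩ := h (fun j => D (e j)) (fun i => hD _) fun i j hij => hd (he.ne hij)
    have := hμ j
    lia

theorem NoClimb.stability {V B : Finset ℕ} {l s r : ℕ} {μ : Finset ℕ → ℕ} (h : NoClimb V l s μ)
    (hs : 1 ≤ s) (hμ : ∀ C, μ C ≤ s + 1) (hBV : B ⊆ V) (hB : #B = l) (hμB : s + 1 ≤ μ B)
    (hr : 4 * s + 3 ≤ r) (hV : r * l ≤ #V) :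
    3 * (∑ C ∈ V.powersetCard l, μ C + s * #((V.powersetCard l).filter fun C => s + 1 ≤ μ C))
      + 2 * (#V - l).choose l ≤ 3 * (s * (#V).choose l) := by
  set a := #((V.powersetCard l).filter fun C => s + 1 ≤ μ C) with ha
  set S := ∑ C ∈ V.powersetCard l, min (μ C) s with hS
  have hsum : ∑ C ∈ V.powersetCard l, μ C = S + a := by
    rw [ha, card_filter, hS, ← sum_add_distrib]
    refine sum_congr rfl fun C _ => ?_
    have := hμ C
    split_ifs <;> lia
  have h1 : S + (3 * (s + 1)) * a ≤ s * (#V).choose l := by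
    refine le_trans ?_ (h.sum_le (r := r) (by lia) hV)
    rw [sum_add_distrib, ← sum_filter, sum_const, smul_eq_mul, mul_comm _ a]
    gcongr
    lia
  have h2 : S + (#V - l).choose l ≤ s * (#V).choose l := by
    obtain ⟨s, rfl⟩ := Nat.exists_eq_add_of_le' hs
    have hcard : #(V \ B) = #V - l := by rw [card_sdiff_of_subset hBV, hB]
    have hP : NoClimb (V \ B) l s μ := by
      intro D hD hd
      have hb : ∀ i, Disjoint (D i) B := fun i =>
        Finset.disjoint_of_subset_left (hD i).1 sdiff_disjoint
      have key := h (Fin.snoc D B) ?_ ?_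
      · obtain ⟨j, hj⟩ := key
        induction j using Fin.lastCases with
        | last => simp at hj; lia
        | cast j => exact ⟨j, by simpa using hj⟩
      · intro i
        induction i using Fin.lastCases with
        | last => simpa using ⟨hBV, hB⟩
        | cast j => simpa using ⟨(hD j).1.trans sdiff_subset, (hD j).2⟩
      · intro i j hij
        induction i using Fin.lastCases with
        | last =>
          induction j using Fin.lastCases with
          | last => exact absurd rfl hij
          | cast j => simpa [Function.onFun] using (hb j).symm
        | cast i =>
          induction j using Fin.lastCases with
          | last => simpa [Function.onFun] using hb i
          | cast j => simpa [Function.onFun] using hd fun h => hij (by rw [h])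
    have h3 := hP.sum_le (r := r - 1) (by lia) (by rw [hcard, Nat.sub_one_mul]; lia)
    have h4 : ∑ C ∈ (V \ B).powersetCard l, min (μ C) (s + 1) ≤ s * (#V - l).choose l := by
      rw [← hcard]
      refine le_trans (sum_le_sum fun C _ => ?_) h3
      split_ifs <;> lia
    have hsub : (V \ B).powersetCard l ⊆ V.powersetCard l := powersetCard_mono sdiff_subset
    have h5 : ∑ C ∈ V.powersetCard l \ (V \ B).powersetCard l, min (μ C) (s + 1) ≤
        #(V.powersetCard l \ (V \ B).powersetCard l) * (s + 1) :=
      sum_le_card_nsmul _ _ _ fun C _ => min_le_right _ _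
    rw [card_sdiff_of_subset hsub, card_powersetCard, card_powersetCard, hcard] at h5
    have h6 := sum_sdiff hsub (f := fun C => min (μ C) (s + 1))
    have h7 : (#V - l).choose l ≤ (#V).choose l := Nat.choose_le_choose _ (by lia)
    rw [hS, ← h6]
    obtain ⟨d, hd⟩ := Nat.exists_eq_add_of_le h7
    rw [hd] at h5 ⊢
    rw [Nat.add_sub_cancel_left] at h5
    linarith
  rw [hsum]
  linarith

/-- The image of `A` under the transposition of `x` and `y`. -/
def swapSet (x y : ℕ) (A : Finset ℕ) : Finset ℕ := A.map (Equiv.swap x y).toEmbedding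

/-- The `(x, y)`-shift of a family: `y` is replaced by `x` whenever this gives a new set. -/
def shift (x y : ℕ) (F : Finset (Finset ℕ)) : Finset (Finset ℕ) :=
  F.image fun A => if x ∉ A ∧ y ∈ A ∧ swapSet x y A ∉ F then swapSet x y A else A

/-- There is no choice of pairwise disjoint representatives of the families `A i`. -/
def NoRainbow {ι : Type*} (A : ι → Finset (Finset ℕ)) : Prop :=
  ∀ D : ι → Finset ℕ, (∀ i, D i ∈ A i) → ¬ Pairwise (Function.onFun Disjoint D)

/-- The sum of all elements of all members of the family. -/
def weight (F : Finset (Finset ℕ)) : ℕ := ∑ A ∈ F, ∑ a ∈ A, a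

/-- `F` is stable under replacing an element by a smaller element of `V`. -/
def ShiftedOn (V : Finset ℕ) (F : Finset (Finset ℕ)) : Prop :=
  ∀ A ∈ F, ∀ i ∈ V, ∀ j ∈ A, i < j → i ∉ A → insert i (A.erase j) ∈ F

theorem mem_swapSet {x y a : ℕ} {A : Finset ℕ} :
    a ∈ swapSet x y A ↔ Equiv.swap x y a ∈ A := by
  simp [swapSet]

theorem left_mem_swapSet {x y : ℕ} {A : Finset ℕ} : x ∈ swapSet x y A ↔ y ∈ A := by
  simp [mem_swapSet]

theorem right_mem_swapSet {x y : ℕ} {A : Finset ℕ} : y ∈ swapSet x y A ↔ x ∈ A := by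
  simp [mem_swapSet]

theorem card_swapSet (x y : ℕ) (A : Finset ℕ) : #(swapSet x y A) = #A := by simp [swapSet]

theorem swapSet_swapSet (x y : ℕ) (A : Finset ℕ) : swapSet x y (swapSet x y A) = A := by
  ext a
  simp [mem_swapSet]

theorem swapSet_of_notMem {x y : ℕ} {A : Finset ℕ} (hx : x ∉ A) (hy : y ∉ A) :
    swapSet x y A = A := by
  ext a
  rw [mem_swapSet, Equiv.swap_apply_def]
  split_ifs with h1 h2 <;> simp_all

theorem swapSet_eq_insert {x y : ℕ} {A : Finset ℕ} (hx : x ∉ A) (hy : y ∈ A) :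
    swapSet x y A = insert x (A.erase y) := by
  ext a
  rw [mem_swapSet, Equiv.swap_apply_def]
  split_ifs with h1 h2 <;> simp_all

theorem swapSet_subset {x y : ℕ} {A V : Finset ℕ} (hx : x ∈ V) (hy : y ∈ V) (hA : A ⊆ V) :
    swapSet x y A ⊆ V := by
  intro a ha
  rw [mem_swapSet, Equiv.swap_apply_def] at ha
  split_ifs at ha with h1 h2
  · exact h1 ▸ hx
  · exact h2 ▸ hy
  · exact hA ha

theorem mem_shift {x y : ℕ} {F : Finset (Finset ℕ)} {A : Finset ℕ} :
    A ∈ shift x y F ↔ (A ∈ F ∧ (x ∉ A → y ∈ A → swapSet x y A ∈ F)) ∨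
      (x ∈ A ∧ y ∉ A ∧ A ∉ F ∧ swapSet x y A ∈ F) := by
  rw [shift, mem_image]
  constructor
  · rintro ⟨B, hB, rfl⟩
    split_ifs with h
    · right
      simp only [left_mem_swapSet, right_mem_swapSet, swapSet_swapSet]
      tauto
    · left
      tauto
  · rintro (⟨h1, h2⟩ | ⟨h1, h2, h3, h4⟩)
    · exact ⟨A, h1, if_neg (by tauto)⟩
    · refine ⟨swapSet x y A, h4, ?_⟩
      rw [if_pos ⟨by rwa [left_mem_swapSet], by rwa [right_mem_swapSet],
        by rwa [swapSet_swapSet]⟩, swapSet_swapSet]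

theorem shift_injOn (x y : ℕ) (F : Finset (Finset ℕ)) :
    Set.InjOn (fun A => if x ∉ A ∧ y ∈ A ∧ swapSet x y A ∉ F then swapSet x y A else A)
      (F : Set (Finset ℕ)) := by
  intro A hA B hB h
  have hA : A ∈ F := hA
  have hB : B ∈ F := hB
  simp only at h
  split_ifs at h with h1 h2 h2
  · rw [← swapSet_swapSet x y A, h, swapSet_swapSet]
  · exact absurd (h ▸ hB) h1.2.2
  · exact absurd (h ▸ hA) h2.2.2
  · exact h

theorem card_shift (x y : ℕ) (F : Finset (Finset ℕ)) : #(shift x y F) = #F :=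
  card_image_of_injOn (shift_injOn x y F)

theorem shift_subset_powersetCard {x y k : ℕ} {V : Finset ℕ} {F : Finset (Finset ℕ)} (hx : x ∈ V)
    (hy : y ∈ V) (hF : F ⊆ V.powersetCard k) : shift x y F ⊆ V.powersetCard k := by
  intro A hA
  rcases mem_shift.1 hA with h | h
  · exact hF h.1
  · have := mem_powersetCard.1 (hF h.2.2.2)
    rw [card_swapSet] at this
    refine mem_powersetCard.2 ⟨?_, this.2⟩
    rw [← swapSet_swapSet x y A]
    exact swapSet_subset hx hy this.1

theorem NoRainbow.map_shift {ι : Type*} {A : ι → Finset (Finset ℕ)} (h : NoRainbow A) (x y : ℕ) :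
    NoRainbow fun i => shift x y (A i) := by
  intro D hD hd
  by_cases hall : ∀ i, D i ∈ A i
  · exact h D hall hd
  push Not at hall
  obtain ⟨i₀, h₀⟩ := hall
  have h₁ := (mem_shift.1 (hD i₀)).resolve_left fun h => h₀ h.1
  refine h (fun i => swapSet x y (D i)) (fun i => ?_)
    fun i j hij => (Finset.disjoint_map _).2 (hd hij)
  by_cases hi : i = i₀
  · exact hi ▸ h₁.2.2.2
  have hx : x ∉ D i := fun hx => Finset.disjoint_left.1 (hd hi) hx h₁.1
  have h₂ := (mem_shift.1 (hD i)).resolve_right fun h => hx h.1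
  by_cases hy : y ∈ D i
  · exact h₂.2 hx hy
  · rw [swapSet_of_notMem hx hy]
    exact h₂.1

theorem sum_swapSet_lt {x y : ℕ} (hxy : x < y) {A : Finset ℕ} (hx : x ∉ A) (hy : y ∈ A) :
    ∑ a ∈ swapSet x y A, a < ∑ a ∈ A, a := by
  rw [swapSet_eq_insert hx hy, sum_insert (fun h => hx (mem_of_mem_erase h)),
    ← add_sum_erase _ _ hy]
  lia

theorem weight_shift_le {x y : ℕ} (hxy : x < y) (F : Finset (Finset ℕ)) :
    weight (shift x y F) ≤ weight F := by
  rw [weight, shift, sum_image (shift_injOn x y F)]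
  refine sum_le_sum fun A _ => ?_
  split_ifs with h
  · exact (sum_swapSet_lt hxy h.1 h.2.1).le
  · exact le_rfl

theorem weight_shift_lt {x y : ℕ} (hxy : x < y) {F : Finset (Finset ℕ)} (hF : shift x y F ≠ F) :
    weight (shift x y F) < weight F := by
  have : ∃ A ∈ F, x ∉ A ∧ y ∈ A ∧ swapSet x y A ∉ F := by
    by_contra! hcon
    refine hF (eq_of_subset_of_card_le (fun A hA => ?_) (card_shift x y F).ge)
    rcases mem_shift.1 hA with h | h
    · exact h.1
    · have := hcon _ h.2.2.2 (by simpa [left_mem_swapSet] using h.2.1)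
        (by simpa [right_mem_swapSet] using h.1)
      rwa [swapSet_swapSet] at this
  obtain ⟨A, hA, h⟩ := this
  rw [weight, shift, sum_image (shift_injOn x y F)]
  refine sum_lt_sum (fun A _ => ?_) ⟨A, hA, ?_⟩
  · split_ifs with h
    · exact (sum_swapSet_lt hxy h.1 h.2.1).le
    · exact le_rfl
  · rw [if_pos h]
    exact sum_swapSet_lt hxy h.1 h.2.1

theorem shiftedOn_of_shift_eq {V : Finset ℕ} {F : Finset (Finset ℕ)}
    (hFV : ∀ A ∈ F, A ⊆ V) (h : ∀ x ∈ V, ∀ y ∈ V, x < y → shift x y F = F) :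
    ShiftedOn V F := by
  intro A hA i hi j hj hij hiA
  have hA' := hA
  rw [← h i hi j (hFV A hA hj) hij] at hA'
  rw [← swapSet_eq_insert hiA hj]
  exact ((mem_shift.1 hA').resolve_right fun h => hiA h.1).2 hiA hj

theorem ShiftedOn.exists_initial {V : Finset ℕ} {F : Finset (Finset ℕ)} (h : ShiftedOn V F)
    (hF : F.Nonempty) : ∃ A ∈ F, ∀ i ∈ V, ∀ j ∈ A, i < j → i ∈ A := by
  obtain ⟨A, hA, hmin⟩ := exists_min_image F (fun A => ∑ a ∈ A, a) hF
  refine ⟨A, hA, fun i hi j hj hij => ?_⟩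
  by_contra hiA
  have := hmin _ (h A hA i hi j hj hij hiA)
  rw [sum_insert (fun h => hiA (mem_of_mem_erase h)), ← add_sum_erase A _ hj] at this
  lia

theorem eq_of_initial {V A B : Finset ℕ} (hA : A ⊆ V) (hB : B ⊆ V) (hc : #A = #B)
    (hAi : ∀ i ∈ V, ∀ j ∈ A, i < j → i ∈ A) (hBi : ∀ i ∈ V, ∀ j ∈ B, i < j → i ∈ B) : A = B := by
  by_contra hne
  obtain ⟨a, ha, haB⟩ := not_subset.1 fun h => hne (eq_of_subset_of_card_le h hc.ge)
  obtain ⟨b, hb, hbA⟩ := not_subset.1 fun h => hne (eq_of_subset_of_card_le h hc.le).symm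
  rcases lt_trichotomy a b with h | h | h
  · exact haB (hBi a (hA ha) b hb h)
  · exact haB (h ▸ hb)
  · exact hbA (hAi b (hB hb) a ha h)

theorem NoRainbow.noClimb {ι : Type*} [Fintype ι] [DecidableEq ι] {s : ℕ}
    (hι : Fintype.card ι = s + 1) {A : ι → Finset (Finset ℕ)} (h : NoRainbow A) (V : Finset ℕ)
    (l : ℕ) : NoClimb V l s fun C => #(univ.filter fun x => C ∈ A x) := by
  intro D hD hd
  by_contra! hcon
  have hall : ∀ J : Finset (Fin (s + 1)),
      #J ≤ #(J.biUnion fun j => univ.filter fun x => D j ∈ A x) := by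
    intro J
    rcases J.eq_empty_or_nonempty with rfl | hne
    · simp
    have h1 : #J ≤ #(Finset.Iic (J.max' hne)) := card_le_card fun x hx => by
      simpa using J.le_max' x hx
    rw [Fin.card_Iic] at h1
    have h2 := hcon (J.max' hne)
    have h3 := card_le_card (subset_biUnion_of_mem
      (fun j : Fin (s + 1) => univ.filter fun x => D j ∈ A x) (J.max'_mem hne))
    lia
  obtain ⟨f, hf, hfA⟩ := (Finset.all_card_le_biUnion_card_iff_exists_injective _).1 hall
  have hb : Function.Bijective f := (Fintype.bijective_iff_injective_and_card f).2
    ⟨hf, by simp [hι]⟩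
  set e := Equiv.ofBijective f hb with he
  refine h (fun x => D (e.symm x)) (fun x => ?_) fun x y hxy => hd (e.symm.injective.ne hxy)
  have h4 := hfA (e.symm x)
  rw [mem_filter] at h4
  have h5 : f (e.symm x) = x := e.apply_symm_apply x
  rw [h5] at h4
  exact h4.2

theorem sum_card_filter_mem {ι : Type*} [Fintype ι] [DecidableEq ι] {A : ι → Finset (Finset ℕ)}
    {P : Finset (Finset ℕ)} (hA : ∀ x, A x ⊆ P) :
    ∑ C ∈ P, #(univ.filter fun x => C ∈ A x) = ∑ x, #(A x) := by
  simp_rw [card_filter]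
  rw [sum_comm]
  refine sum_congr rfl fun x _ => ?_
  rw [← card_filter, filter_mem_eq_inter, inter_eq_right.2 (hA x)]

theorem NoRainbow.stability {ι : Type*} [Fintype ι] [DecidableEq ι] {s l r : ℕ}
    (hι : Fintype.card ι = s + 1) (hs : 1 ≤ s) {V : Finset ℕ} (hr : 4 * s + 3 ≤ r)
    (hV : r * l ≤ #V) {A : ι → Finset (Finset ℕ)} (hA : ∀ x, A x ⊆ V.powersetCard l)
    (hne : ∀ x, (A x).Nonempty) (h : NoRainbow A) :
    3 * ∑ x, #(A x) + 2 * (#V - l).choose l ≤ 3 * (s * (#V).choose l) := by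
  induction hw : ∑ x, weight (A x) using Nat.strong_induction_on generalizing A with
  | _ w ih =>
    by_cases hsh : ∃ x ∈ V, ∃ y ∈ V, x < y ∧ ∃ i, shift x y (A i) ≠ A i
    · obtain ⟨x, hx, y, hy, hxy, i, hi⟩ := hsh
      have := ih (∑ i, weight (shift x y (A i))) ?_ (A := fun i => shift x y (A i))
        (fun i => shift_subset_powersetCard hx hy (hA i)) (fun i => (hne i).image _)
        (h.map_shift x y) rfl
      · simpa only [card_shift] using this
      · rw [← hw]
        exact sum_lt_sum (fun i _ => weight_shift_le hxy _) ⟨i, mem_univ _, weight_shift_lt hxy hi⟩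
    · push Not at hsh
      have hS : ∀ i, ShiftedOn V (A i) := fun i => shiftedOn_of_shift_eq
        (fun B hB => (mem_powersetCard.1 (hA i hB)).1) fun x hx y hy hxy => hsh x hx y hy hxy i
      choose B hBA hBi using fun i => (hS i).exists_initial (hne i)
      have hB : ∀ i, B i ⊆ V ∧ #(B i) = l := fun i => mem_powersetCard.1 (hA i (hBA i))
      have : Nonempty ι := Fintype.card_pos_iff.1 (by lia)
      obtain ⟨i₀⟩ := this
      have hBe : ∀ i, B i = B i₀ := fun i =>
        eq_of_initial (hB i).1 (hB i₀).1 ((hB i).2.trans (hB i₀).2.symm) (hBi i) (hBi i₀)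
      have hst := (h.noClimb hι V l).stability hs (B := B i₀) ?_ (hB i₀).1 (hB i₀).2 ?_ hr hV
      · rw [sum_card_filter_mem hA] at hst
        lia
      · intro C
        rw [← hι]
        exact card_filter_le _ _
      · rw [filter_true_of_mem fun i _ => hBe i ▸ hBA i, card_univ, hι]

theorem card_mul_le_card_shadow_mul_of_subset {V : Finset ℕ} {k : ℕ} {F : Finset (Finset ℕ)}
    (hF : F ⊆ V.powersetCard (k + 1)) : #F * (k + 1) ≤ #(shadow F) * (#V - k) := by
  refine card_mul_le_card_mul (fun A B => B ⊆ A) (fun A hA => ?_) fun B hB => ?_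
  · have hc := (mem_powersetCard.1 (hF hA)).2
    rw [← hc, ← card_image_of_injOn (s := A) (f := fun a => A.erase a)
      fun a ha b _ h => (erase_inj A ha).1 h]
    refine card_le_card fun B hB => ?_
    obtain ⟨a, ha, rfl⟩ := mem_image.1 hB
    exact mem_filter.2 ⟨erase_mem_shadow hA ha, erase_subset _ _⟩
  · obtain ⟨a, ha, haB⟩ := mem_shadow_iff_insert_mem.1 hB
    have h1 := mem_powersetCard.1 (hF haB)
    rw [card_insert_of_notMem ha] at h1
    have hBV : B ⊆ V := (subset_insert _ _).trans h1.1
    have hsub : F.bipartiteBelow (fun A B => B ⊆ A) B ⊆ (V \ B).image fun a => insert a B := by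
      intro A hA
      obtain ⟨hA, hBA⟩ := mem_filter.1 hA
      have h2 := mem_powersetCard.1 (hF hA)
      obtain ⟨b, hb⟩ := card_eq_one.1 (show #(A \ B) = 1 by
        rw [card_sdiff_of_subset hBA]; lia)
      have hbA : b ∈ A \ B := by simp [hb]
      refine mem_image.2 ⟨b, sdiff_subset_sdiff h2.1 le_rfl hbA, ?_⟩
      rw [insert_eq, ← hb, sdiff_union_of_subset hBA]
    refine (card_le_card hsub).trans (card_image_le.trans ?_)
    rw [card_sdiff_of_subset hBV]
    lia

/-- A shifted `k`-uniform family without `s + 1` pairwise disjoint members has at most `s` times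
as many members as its shadow. -/
theorem ShiftedOn.card_le_mul_card_shadow {s : ℕ} (hs : 1 ≤ s) {V : Finset ℕ} :
    ∀ {k : ℕ} {F : Finset (Finset ℕ)}, F ⊆ V.powersetCard (k + 1) → ShiftedOn V F →
      NoRainbow (fun _ : Fin (s + 1) => F) → #F ≤ s * #(shadow F) := by
  induction V using Finset.strongInduction with
  | H V ih =>
    intro k F hF hS hR
    rcases F.eq_empty_or_nonempty with rfl | hne
    · simp
    rcases k with _ | k
    · have h1 : ∅ ∈ shadow F := by
        obtain ⟨A, hA⟩ := hne
        obtain ⟨a, rfl⟩ := card_eq_one.1 (mem_powersetCard.1 (hF hA)).2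
        exact mem_shadow_iff_insert_mem.2 ⟨a, by simp, by simpa using hA⟩
      have h2 : 0 < #(shadow F) := card_pos.2 ⟨_, h1⟩
      have h3 : #F ≤ s := by
        by_contra! hcon
        obtain ⟨G, hG, hGc⟩ := exists_subset_card_eq hcon
        let e := G.equivFinOfCardEq hGc
        refine hR (fun i => (e.symm i : Finset ℕ)) (fun i => hG (e.symm i).2) fun i j hij => ?_
        have hne : (e.symm i : Finset ℕ) ≠ e.symm j :=
          fun h => hij (e.symm.injective (Subtype.ext h))
        obtain ⟨a, ha⟩ := card_eq_one.1 (mem_powersetCard.1 (hF (hG (e.symm i).2))).2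
        obtain ⟨b, hb⟩ := card_eq_one.1 (mem_powersetCard.1 (hF (hG (e.symm j).2))).2
        simp only [Function.onFun]
        rw [ha, hb] at hne ⊢
        simpa using hne
      nlinarith
    by_cases hV : #V < (s + 1) * (k + 2)
    · have h1 := card_mul_le_card_shadow_mul_of_subset hF
      have h2 : #V - (k + 1) ≤ s * (k + 2) := by
        have : (s + 1) * (k + 2) = s * (k + 2) + (k + 2) := by ring
        lia
      have h3 := h1.trans (Nat.mul_le_mul_left _ h2)
      refine Nat.le_of_mul_le_mul_right ?_ (show 0 < k + 1 + 1 by lia)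
      linarith
    push Not at hV
    have hVne : V.Nonempty := card_pos.1 (by nlinarith)
    set x := V.max' hVne with hx
    have hxV : x ∈ V := V.max'_mem hVne
    have hlt : ∀ y ∈ V, y ≠ x → y < x := fun y hy hyx => lt_of_le_of_ne (V.le_max' y hy) hyx
    have hlarge : #(F.memberSubfamily x) ≤ s * #(shadow (F.memberSubfamily x)) := by
      refine ih (V.erase x) (erase_ssubset hxV) (k := k) ?_ ?_ ?_
      · intro A hA
        rw [mem_memberSubfamily] at hA
        have h1 := mem_powersetCard.1 (hF hA.1)
        rw [card_insert_of_notMem hA.2] at h1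
        refine mem_powersetCard.2 ⟨fun a ha => mem_erase.2 ⟨fun h => hA.2 (h ▸ ha), ?_⟩, by lia⟩
        exact h1.1 (mem_insert_of_mem ha)
      · intro A hA i hi j hj hij hiA
        rw [mem_memberSubfamily] at hA ⊢
        obtain ⟨hix, hiV⟩ := mem_erase.1 hi
        have h1 := hS _ hA.1 i hiV j (mem_insert_of_mem hj) hij (by simp [hix, hiA])
        have hjx : j ≠ x := fun h => hA.2 (h ▸ hj)
        rw [erase_insert_of_ne hjx.symm, insert_comm] at h1
        refine ⟨h1, ?_⟩
        simp [hix.symm, hA.2]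
      · intro D hD hd
        have hD' : ∀ i, insert x (D i) ∈ F ∧ x ∉ D i := fun i => mem_memberSubfamily.1 (hD i)
        set U := univ.biUnion D with hU
        have hDU : ∀ i, D i ⊆ U := fun i => subset_biUnion_of_mem D (mem_univ i)
        have hUc : #U ≤ (s + 1) * (k + 1) := by
          refine card_biUnion_le.trans ((sum_le_card_nsmul _ _ (k + 1) fun i _ => ?_).trans ?_)
          · have := (mem_powersetCard.1 (hF (hD' i).1)).2
            rw [card_insert_of_notMem (hD' i).2] at this
            lia
          · simp
        have hVU : s + 1 ≤ #(V \ U) := by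
          have := le_card_sdiff U V
          have : (s + 1) * (k + 2) = (s + 1) * (k + 1) + (s + 1) := by ring
          lia
        obtain ⟨W, hW, hWc⟩ := exists_subset_card_eq hVU
        let e := W.equivFinOfCardEq hWc
        have he : ∀ i, (e.symm i : ℕ) ∈ V ∧ (e.symm i : ℕ) ∉ U := fun i =>
          mem_sdiff.1 (hW (e.symm i).2)
        refine hR (fun i => insert (e.symm i : ℕ) (D i)) (fun i => ?_) fun i j hij => ?_
        · by_cases h : (e.symm i : ℕ) = x
          · rw [h]
            exact (hD' i).1
          · have := hS _ (hD' i).1 (e.symm i) (he i).1 x (mem_insert_self _ _)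
              (hlt _ (he i).1 h) (by
                rw [mem_insert, not_or]
                exact ⟨h, fun h' => (he i).2 (hDU i h')⟩)
            rwa [erase_insert (hD' i).2] at this
        · simp only [Function.onFun, disjoint_insert_left, disjoint_insert_right, mem_insert,
            not_or]
          exact ⟨⟨fun h => hij (e.symm.injective (Subtype.ext h.symm)),
            fun h => (he j).2 (hDU i h)⟩, fun h => (he i).2 (hDU j h), hd hij⟩
    have hsmall : #(F.nonMemberSubfamily x) ≤ s * #(shadow (F.nonMemberSubfamily x)) := by
      refine ih (V.erase x) (erase_ssubset hxV) (k := k + 1) ?_ ?_ ?_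
      · intro A hA
        rw [mem_nonMemberSubfamily] at hA
        have h1 := mem_powersetCard.1 (hF hA.1)
        exact mem_powersetCard.2
          ⟨fun a ha => mem_erase.2 ⟨fun h => hA.2 (h ▸ ha), h1.1 ha⟩, h1.2⟩
      · intro A hA i hi j hj hij hiA
        rw [mem_nonMemberSubfamily] at hA ⊢
        obtain ⟨hix, hiV⟩ := mem_erase.1 hi
        refine ⟨hS _ hA.1 i hiV j hj hij hiA, ?_⟩
        simp [hix.symm, hA.2]
      · exact fun D hD => hR D fun i => (mem_nonMemberSubfamily.1 (hD i)).1
    have h1 : shadow (F.memberSubfamily x) ⊆ (shadow F).memberSubfamily x := by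
      intro B hB
      obtain ⟨a, ha, haB⟩ := mem_shadow_iff_insert_mem.1 hB
      rw [mem_memberSubfamily, mem_insert, not_or, insert_comm] at haB
      refine mem_memberSubfamily.2 ⟨mem_shadow_iff_insert_mem.2 ⟨a, ?_, haB.1⟩, haB.2.2⟩
      rw [mem_insert, not_or]
      exact ⟨fun h => haB.2.1 h.symm, ha⟩
    have h2 : shadow (F.nonMemberSubfamily x) ⊆ (shadow F).nonMemberSubfamily x := by
      intro B hB
      obtain ⟨a, ha, haB⟩ := mem_shadow_iff_insert_mem.1 hB
      rw [mem_nonMemberSubfamily, mem_insert, not_or] at haB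
      exact mem_nonMemberSubfamily.2 ⟨mem_shadow_iff_insert_mem.2 ⟨a, ha, haB.1⟩, haB.2.2⟩
    have h3 := card_le_card h1
    have h4 := card_le_card h2
    rw [← card_memberSubfamily_add_card_nonMemberSubfamily x F,
      ← card_memberSubfamily_add_card_nonMemberSubfamily x (shadow F)]
    nlinarith

/-- The `l`-subsets `C` of `U \ T` with `C ∪ {x} ∈ F`. -/
def link (U T : Finset ℕ) (l : ℕ) (F : Finset (Finset ℕ)) (x : ℕ) : Finset (Finset ℕ) :=
  ((U \ T).powersetCard l).filter fun C => insert x C ∈ F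

theorem mem_link {U T C : Finset ℕ} {l x : ℕ} {F : Finset (Finset ℕ)} :
    C ∈ link U T l F x ↔ (C ⊆ U \ T ∧ #C = l) ∧ insert x C ∈ F := by
  rw [link, mem_filter, mem_powersetCard]

theorem link_subset (U T : Finset ℕ) (l : ℕ) (F : Finset (Finset ℕ)) (x : ℕ) :
    link U T l F x ⊆ (U \ T).powersetCard l := filter_subset _ _

theorem card_filter_inter_eq_singleton {U T : Finset ℕ} {l x : ℕ} {F : Finset (Finset ℕ)}
    (hF : F ⊆ U.powersetCard (l + 1)) (hx : x ∈ T) :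
    #(F.filter fun A => A ∩ T = {x}) = #(link U T l F x) := by
  symm
  refine card_nbij' (fun C => insert x C) (fun A => A.erase x) ?_ ?_ ?_ ?_
  · intro C hC
    obtain ⟨⟨h1, _⟩, h2⟩ := mem_link.1 hC
    refine mem_filter.2 ⟨h2, ?_⟩
    rw [insert_inter_of_mem hx, disjoint_iff_inter_eq_empty.1
      (disjoint_of_subset_left h1 sdiff_disjoint), insert_empty_eq]
  · intro A hA
    obtain ⟨h1, h2⟩ := mem_filter.1 hA
    have hxA : x ∈ A := (mem_inter.1 (h2.symm ▸ mem_singleton_self x : x ∈ A ∩ T)).1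
    have h3 := mem_powersetCard.1 (hF h1)
    refine mem_link.2 ⟨⟨fun a ha => mem_sdiff.2 ⟨h3.1 (mem_of_mem_erase ha), fun haT => ?_⟩, ?_⟩, ?_⟩
    · have : a ∈ A ∩ T := mem_inter.2 ⟨mem_of_mem_erase ha, haT⟩
      rw [h2, mem_singleton] at this
      exact ne_of_mem_erase ha this
    · rw [card_erase_of_mem hxA]
      lia
    · rwa [insert_erase hxA]
  · intro C hC
    obtain ⟨⟨h1, _⟩, h2⟩ := mem_link.1 hC
    exact erase_insert fun h => (mem_sdiff.1 (h1 h)).2 hx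
  · intro A hA
    obtain ⟨h1, h2⟩ := mem_filter.1 hA
    exact insert_erase (mem_inter.1 (h2.symm ▸ mem_singleton_self x : x ∈ A ∩ T)).1

theorem card_eq_sum_link {U T : Finset ℕ} {l : ℕ} {F : Finset (Finset ℕ)}
    (hF : F ⊆ U.powersetCard (l + 1)) :
    #F = #(F.filter fun A => Disjoint A T) + ∑ x ∈ T, #(link U T l F x)
      + #(F.filter fun A => 2 ≤ #(A ∩ T)) := by
  have h1 : ∑ x ∈ T, #(link U T l F x) = #(F.filter fun A => #(A ∩ T) = 1) := by
    rw [← sum_congr rfl fun x hx => card_filter_inter_eq_singleton hF hx, ← card_biUnion]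
    · congr 1
      ext A
      simp only [mem_biUnion, mem_filter, card_eq_one]
      constructor
      · rintro ⟨x, _, h1, h2⟩
        exact ⟨h1, x, h2⟩
      · rintro ⟨h1, x, h2⟩
        exact ⟨x, (mem_inter.1 (h2.symm ▸ mem_singleton_self x : x ∈ A ∩ T)).2, h1, h2⟩
    · intro x _ y _ hxy
      refine disjoint_filter.2 fun A _ h1 h2 => hxy ?_
      simpa using h1.symm.trans h2
  rw [h1, card_filter, card_filter, card_filter, ← sum_add_distrib, ← sum_add_distrib,
    card_eq_sum_ones]
  refine sum_congr rfl fun A _ => ?_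
  have h2 : Disjoint A T ↔ #(A ∩ T) = 0 := by rw [card_eq_zero, disjoint_iff_inter_eq_empty]
  rw [if_congr h2 rfl rfl]
  split_ifs <;> lia

theorem card_add_choose_le {n s l : ℕ} {U T : Finset ℕ} (hU : #U = n) (hTU : T ⊆ U)
    (hT : #T = s + 1) {F : Finset (Finset ℕ)} (hF : F ⊆ U.powersetCard (l + 1)) :
    #F + s * (n - s - 1).choose l + (n - s).choose (l + 1) ≤
      #(F.filter fun A => Disjoint A T) + ∑ x ∈ T, #(link U T l F x) + n.choose (l + 1) := by
  have h1 := card_eq_sum_link (T := T) (l := l) (subset_refl (U.powersetCard (l + 1)))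
  have h2 := card_eq_sum_link (T := T) hF
  have h3 : #(F.filter fun A => 2 ≤ #(A ∩ T)) ≤
      #((U.powersetCard (l + 1)).filter fun A => 2 ≤ #(A ∩ T)) :=
    card_le_card (filter_subset_filter _ hF)
  have hc : #(U \ T) = n - s - 1 := by rw [card_sdiff_of_subset hTU, hU, hT]; lia
  have h4 : ∀ x ∈ T, link U T l (U.powersetCard (l + 1)) x = (U \ T).powersetCard l := by
    intro x hx
    refine filter_true_of_mem fun C hC => ?_
    obtain ⟨hC, hCl⟩ := mem_powersetCard.1 hC
    refine mem_powersetCard.2 ⟨insert_subset (hTU hx) (hC.trans sdiff_subset), ?_⟩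
    rw [card_insert_of_notMem fun h => (mem_sdiff.1 (hC h)).2 hx, hCl]
  have h5 : (U.powersetCard (l + 1)).filter (fun A => Disjoint A T) =
      (U \ T).powersetCard (l + 1) := by
    ext A
    simp only [mem_filter, mem_powersetCard, subset_sdiff]
    tauto
  rw [sum_congr rfl fun x hx => by rw [h4 x hx], h5, sum_const, card_powersetCard,
    card_powersetCard, card_powersetCard, hU, hc, hT, smul_eq_mul] at h1
  have hle := card_le_card hTU
  have h6 : (n - s).choose (l + 1) = (n - s - 1).choose l + (n - s - 1).choose (l + 1) := by
    obtain ⟨m, hm⟩ : ∃ m, n - s = m + 1 := ⟨n - s - 1, by lia⟩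
    rw [hm]
    exact Nat.choose_succ_succ m l
  rw [h6]
  linarith

theorem NoRainbow.link {s l : ℕ} {F : Finset (Finset ℕ)} (h : NoRainbow fun _ : Fin (s + 1) => F)
    (U : Finset ℕ) {T : Finset ℕ} (hT : #T = s + 1) :
    NoRainbow fun x : T => link U T l F x := by
  intro D hD hd
  let e := T.equivFinOfCardEq hT
  refine h (fun i => insert (e.symm i : ℕ) (D (e.symm i)))
    (fun i => (mem_link.1 (hD (e.symm i))).2) fun i j hij => ?_
  have h1 : ∀ x y : T, (x : ℕ) ∉ D y := fun x y hx =>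
    (mem_sdiff.1 ((mem_link.1 (hD y)).1.1 hx)).2 x.2
  simp only [Function.onFun, disjoint_insert_left, disjoint_insert_right, mem_insert, not_or]
  exact ⟨⟨fun h => hij (e.symm.injective (Subtype.ext h.symm)), h1 _ _⟩, h1 _ _,
    hd (e.symm.injective.ne hij)⟩

theorem stability_of_cover {n s l : ℕ} (hs : 1 ≤ s) (hsl : 2 * s ≤ l) (hn : 2 * (l + 1) ^ 2 ≤ n)
    {U T : Finset ℕ} (hU : #U = n) (hTU : T ⊆ U) (hT : #T = s + 1) {F : Finset (Finset ℕ)}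
    (hF : F ⊆ U.powersetCard (l + 1)) (hR : NoRainbow fun _ : Fin (s + 1) => F)
    (hcov : ∀ A ∈ F, ¬ Disjoint A T) (hne : ∀ x ∈ T, ∃ A ∈ F, Disjoint A (T.erase x)) :
    3 * #F + 2 * (n - s - 1 - l).choose l + 3 * (n - s).choose (l + 1) ≤
      3 * n.choose (l + 1) := by
  have hc : #(U \ T) = n - s - 1 := by rw [card_sdiff_of_subset hTU, hU, hT]; lia
  have h1 := card_add_choose_le hU hTU hT hF
  have h2 : F.filter (fun A => Disjoint A T) = ∅ := filter_false_of_mem hcov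
  have h3 := (hR.link U hT (l := l)).stability (s := s) (r := 2 * l + 3) (by simp [hT]) hs
    (by lia) (by rw [hc]; apply Nat.le_sub_of_add_le; apply Nat.le_sub_of_add_le; nlinarith)
    (fun x : T => link_subset U T l F x) ?_
  · rw [hc, sum_coe_sort T fun x => #(link U T l F x)] at h3
    rw [h2, card_empty] at h1
    linarith
  · intro x
    obtain ⟨A, hA, hAT⟩ := hne x x.2
    have hAx : A ∩ T = {(x : ℕ)} := by
      have h4 : A ∩ T ⊆ {(x : ℕ)} := by
        intro a ha
        by_contra hax
        exact Finset.disjoint_left.1 hAT (mem_inter.1 ha).1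
          (mem_erase.2 ⟨by simpa using hax, (mem_inter.1 ha).2⟩)
      refine (subset_singleton_iff.1 h4).resolve_left fun h => hcov A hA ?_
      exact disjoint_iff_inter_eq_empty.2 h
    rw [← card_pos, ← card_filter_inter_eq_singleton hF x.2, card_pos]
    exact ⟨A, mem_filter.2 ⟨hA, hAx⟩⟩

theorem ShiftedOn.stability {n s l : ℕ} (hs : 1 ≤ s) (hsl : 2 * s ≤ l)
    (hn : 2 * (l + 1) ^ 2 ≤ n) {F : Finset (Finset ℕ)}
    (hF : F ⊆ (Icc 1 n).powersetCard (l + 1)) (hR : NoRainbow fun _ : Fin (s + 1) => F)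
    (hS : ShiftedOn (Icc 1 n) F) (hcov : ∃ A ∈ F, Disjoint A (Icc 1 s)) :
    3 * #F + 2 * (n - s - 1 - l).choose l + 3 * (n - s).choose (l + 1) ≤
      3 * n.choose (l + 1) := by
  have hsn : s + 1 ≤ n := by nlinarith
  set U := Icc 1 n with hUdef
  set T := Icc 1 (s + 1) with hTdef
  have hU : #U = n := by simp [hUdef]
  have hT : #T = s + 1 := by simp [hTdef]
  have hTU : T ⊆ U := Icc_subset_Icc le_rfl hsn
  have hV : ∀ a, a ∈ U \ T ↔ s + 1 < a ∧ a ≤ n := by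
    intro a
    simp only [hUdef, hTdef, mem_sdiff, mem_Icc]
    lia
  have hTx : ∀ x ∈ T, x ∈ U ∧ x ≤ s + 1 := fun x hx => ⟨hTU hx, (mem_Icc.1 hx).2⟩
  have hc : #(U \ T) = n - s - 1 := by rw [card_sdiff_of_subset hTU, hU, hT]; lia
  have h1 := card_add_choose_le hU hTU hT hF
  set F₀ := F.filter fun A => Disjoint A T with hF₀
  set μ : Finset ℕ → ℕ := fun C => #(univ.filter fun x : T => C ∈ link U T l F x) with hμ
  have hμle : ∀ C, μ C ≤ s + 1 := by
    intro C
    refine (card_filter_le _ _).trans ?_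
    simp [hT]
  have hμeq : ∀ C ∈ (U \ T).powersetCard l, (∀ x ∈ T, insert x C ∈ F) → s + 1 ≤ μ C := by
    intro C hC h
    simp only [hμ]
    rw [filter_true_of_mem fun (x : T) _ => mem_link.2 ⟨mem_powersetCard.1 hC, h x x.2⟩]
    simp [hT]
  obtain ⟨A, hA, hAs⟩ := hcov
  have hAU := mem_powersetCard.1 (hF hA)
  have hAne : A.Nonempty := card_pos.1 (by lia)
  set j := A.min' hAne with hj
  have hjA : j ∈ A := A.min'_mem hAne
  have hjs : s + 1 ≤ j := by
    by_contra! hcon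
    exact Finset.disjoint_left.1 hAs hjA
      (mem_Icc.2 ⟨(mem_Icc.1 (hAU.1 hjA)).1, by lia⟩)
  have hB : A.erase j ∈ (U \ T).powersetCard l := by
    refine mem_powersetCard.2 ⟨fun a ha => (hV a).2 ?_, by rw [card_erase_of_mem hjA]; lia⟩
    obtain ⟨haj, ha⟩ := mem_erase.1 ha
    have := A.min'_le a ha
    have := (mem_Icc.1 (hAU.1 ha)).2
    lia
  have hBμ : s + 1 ≤ μ (A.erase j) := by
    refine hμeq _ hB fun x hx => ?_
    rcases eq_or_ne x j with rfl | hxj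
    · rwa [insert_erase hjA]
    · have hxj : x < j := lt_of_le_of_ne ((hTx x hx).2.trans hjs) hxj
      exact hS A hA x (hTx x hx).1 j hjA hxj fun h => absurd (A.min'_le x h) (by lia)
  have h2 := ((hR.link U hT (l := l)).noClimb (s := s) (by simp [hT]) (U \ T) l).stability hs hμle
    (r := 2 * l + 3) (mem_powersetCard.1 hB).1 (mem_powersetCard.1 hB).2 hBμ (by lia)
    (by rw [hc]; apply Nat.le_sub_of_add_le; apply Nat.le_sub_of_add_le; nlinarith)
  rw [sum_card_filter_mem (fun x : T => link_subset U T l F x), hc,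
    sum_coe_sort T fun x => #(link U T l F x)] at h2
  have hF₀V : F₀ ⊆ (U \ T).powersetCard (l + 1) := by
    intro A hA
    obtain ⟨hA, hAT⟩ := mem_filter.1 hA
    have := mem_powersetCard.1 (hF hA)
    exact mem_powersetCard.2 ⟨subset_sdiff.2 ⟨this.1, hAT⟩, this.2⟩
  have hF₀S : ShiftedOn (U \ T) F₀ := by
    intro A hA i hi j hj hij hiA
    obtain ⟨hA, hAT⟩ := mem_filter.1 hA
    obtain ⟨hiU, hiT⟩ := mem_sdiff.1 hi
    refine mem_filter.2 ⟨hS A hA i hiU j hj hij hiA, disjoint_insert_left.2 ⟨hiT, ?_⟩⟩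
    exact disjoint_of_subset_left (erase_subset _ _) hAT
  have h3 := hF₀S.card_le_mul_card_shadow hs hF₀V fun D hD =>
    hR D fun i => (mem_filter.1 (hD i)).1
  have h4 : shadow F₀ ⊆ ((U \ T).powersetCard l).filter fun C => s + 1 ≤ μ C := by
    intro C hC
    obtain ⟨a, ha, haC⟩ := mem_shadow_iff_insert_mem.1 hC
    have h5 := mem_powersetCard.1 (hF₀V haC)
    rw [card_insert_of_notMem ha] at h5
    have h6 : C ∈ (U \ T).powersetCard l :=
      mem_powersetCard.2 ⟨(subset_insert _ _).trans h5.1, by lia⟩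
    have h7 := (hV a).1 (h5.1 (mem_insert_self _ _))
    refine mem_filter.2 ⟨h6, hμeq C h6 fun x hx => ?_⟩
    have h8 := hS _ (mem_filter.1 haC).1 x (hTx x hx).1 a (mem_insert_self _ _)
      ((hTx x hx).2.trans_lt h7.1) fun h => (mem_sdiff.1 (h5.1 h)).2 hx
    rwa [erase_insert ha] at h8
  have h5 := h3.trans (Nat.mul_le_mul_left s (card_le_card h4))
  linarith

/-- A `k`-uniform family without `s + 1` pairwise disjoint members either has a cover of size `s`
or is substantially smaller than the family of all `k`-sets meeting a given `s`-set. -/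
theorem NoRainbow.cover_or_card_le {n s l : ℕ} (hs : 1 ≤ s) (hsl : 2 * s ≤ l)
    (hn : 2 * (l + 1) ^ 2 ≤ n) {F : Finset (Finset ℕ)}
    (hF : F ⊆ (Icc 1 n).powersetCard (l + 1)) (hR : NoRainbow fun _ : Fin (s + 1) => F) :
    (∃ T ⊆ Icc 1 n, #T = s ∧ ∀ A ∈ F, ¬ Disjoint A T) ∨
    3 * #F + 2 * (n - s - 1 - l).choose l + 3 * (n - s).choose (l + 1) ≤
      3 * n.choose (l + 1) := by
  induction hw : weight F using Nat.strong_induction_on generalizing F with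
  | _ w ih =>
    rw [or_iff_not_imp_left]
    intro hno
    by_cases hsh : ∃ x ∈ Icc 1 n, ∃ y ∈ Icc 1 n, x < y ∧ shift x y F ≠ F
    · obtain ⟨x, hx, y, hy, hxy, hne⟩ := hsh
      rcases ih _ (hw ▸ weight_shift_lt hxy hne) (shift_subset_powersetCard hx hy hF)
        (hR.map_shift x y) rfl with ⟨T, hT, hTs, hcov⟩ | h
      · have hcov' : ∀ A ∈ F, ¬ Disjoint A (insert y T) := by
          intro A hA hd
          rw [disjoint_insert_right] at hd
          exact hcov A (mem_shift.2 (Or.inl ⟨hA, fun _ h => absurd h hd.1⟩)) hd.2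
        have hyT : y ∉ T := fun h => hno ⟨T, hT, hTs, by rwa [insert_eq_of_mem h] at hcov'⟩
        have hsub : insert y T ⊆ Icc 1 n := insert_subset hy hT
        have hc : #(insert y T) = s + 1 := by rw [card_insert_of_notMem hyT, hTs]
        refine stability_of_cover hs hsl hn (by simp) hsub hc hF hR hcov' fun z hz => ?_
        by_contra! hcon
        exact hno ⟨_, (erase_subset _ _).trans hsub, by rw [card_erase_of_mem hz, hc]; lia, hcon⟩
      · rwa [card_shift] at h
    · push Not at hsh
      refine ShiftedOn.stability hs hsl hn hF hR
        (shiftedOn_of_shift_eq (fun A hA => (mem_powersetCard.1 (hF hA)).1) hsh) ?_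
      by_contra! hcon
      exact hno ⟨Icc 1 s, Icc_subset_Icc le_rfl (by nlinarith), by simp, hcon⟩

theorem choose_add_le_pow_mul_choose {m d : ℕ} {x : ℝ} (hx : 0 ≤ x) :
    ∀ l : ℕ, l ≤ m → (d : ℝ) ≤ x * (m - l + 1) →
      ((m + d).choose l : ℝ) ≤ (1 + x) ^ l * m.choose l := by
  intro l
  induction l with
  | zero => intro _ _; simp
  | succ l ih =>
    intro hl hd
    push_cast at hd
    have h1 := ih (by lia) (by nlinarith)
    have h2 : ((m + d).choose (l + 1) : ℝ) * (l + 1) = (m + d).choose l * (m + d - l) := by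
      have := Nat.choose_succ_right_eq (m + d) l
      rw [← Nat.cast_add, ← Nat.cast_sub (by lia)]
      exact_mod_cast this
    have h3 : (m.choose (l + 1) : ℝ) * (l + 1) = m.choose l * (m - l) := by
      have := Nat.choose_succ_right_eq m l
      rw [← Nat.cast_sub (by lia)]
      exact_mod_cast this
    have hml : (l : ℝ) ≤ m := by exact_mod_cast (by lia : l ≤ m)
    refine le_of_mul_le_mul_right ?_ (show (0 : ℝ) < l + 1 by positivity)
    calc ((m + d).choose (l + 1) : ℝ) * (l + 1) = (m + d).choose l * (m + d - l) := h2
      _ ≤ ((1 + x) ^ l * m.choose l) * ((1 + x) * (m - l)) := by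
        refine mul_le_mul h1 (by linarith) ?_ (by positivity)
        have : (0 : ℝ) ≤ d := by positivity
        linarith
      _ = (1 + x) ^ (l + 1) * (m.choose l * (m - l)) := by ring
      _ = (1 + x) ^ (l + 1) * m.choose (l + 1) * (l + 1) := by rw [← h3]; ring

theorem choose_lt_two_mul_choose {n s l : ℕ} (hs : 3 * s ≤ l + 1) (hn : 2 * (l + 1) ^ 2 ≤ n) :
    (n - 1).choose l < 2 * (n - s - 1 - l).choose l := by
  have hn' : 2 * l ^ 2 + 4 * l + 2 ≤ n := by linarith
  have hsn : s + 1 + l ≤ n := by nlinarith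
  obtain ⟨m, hm⟩ : ∃ m, n = m + s + 1 + l := ⟨n - s - 1 - l, by lia⟩
  have hlm : l ≤ m := by nlinarith
  have h1 : n - s - 1 - l = m := by lia
  have h2 : n - 1 = m + (s + l) := by lia
  rw [h1, h2]
  have hlmR : (l : ℝ) ≤ m := by exact_mod_cast hlm
  have hpos : (0 : ℝ) < m - l + 1 := by linarith
  have hkey : (l : ℝ) * (s + l) ≤ 2 / 3 * (m - l + 1) := by
    have h3 : (3 * s : ℝ) ≤ l + 1 := by exact_mod_cast hs
    have h4 : (2 * l ^ 2 + 4 * l + 2 : ℝ) ≤ m + s + 1 + l := by exact_mod_cast hm ▸ hn'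
    have h5 : (0 : ℝ) ≤ l := by positivity
    nlinarith
  set x : ℝ := (s + l) / (m - l + 1) with hx
  have hx0 : 0 ≤ x := by positivity
  have h3 := choose_add_le_pow_mul_choose (m := m) (d := s + l) hx0 l hlm (by
    rw [hx, div_mul_cancel₀ _ hpos.ne']
    push_cast
    exact le_rfl)
  have h4 : (1 + x) ^ l ≤ Real.exp (2 / 3) := by
    calc (1 + x) ^ l ≤ Real.exp x ^ l := by
          gcongr
          linarith [Real.add_one_le_exp x]
      _ = Real.exp (l * x) := (Real.exp_nat_mul x l).symm
      _ ≤ Real.exp (2 / 3) := by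
          rw [Real.exp_le_exp, hx, ← mul_div_assoc, div_le_iff₀ hpos]
          exact hkey
  have h5 : Real.exp (2 / 3) < 2 := by
    have h6 : Real.exp (2 / 3) ^ 3 = Real.exp 1 ^ 2 := by
      rw [← Real.exp_nat_mul, ← Real.exp_nat_mul]
      norm_num
    have h7 : Real.exp 1 ^ 2 < 2 ^ 3 := by
      have := Real.exp_one_lt_d9
      have := Real.exp_pos 1
      nlinarith
    exact lt_of_pow_lt_pow_left₀ 3 (by norm_num) (h6 ▸ h7)
  have h6 : (0 : ℝ) < m.choose l := by exact_mod_cast Nat.choose_pos hlm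
  have h7 : ((m + (s + l)).choose l : ℝ) < 2 * m.choose l :=
    h3.trans_lt (mul_lt_mul_of_pos_right (h4.trans_lt h5) h6)
  exact_mod_cast h7

theorem choose_add_eq_sum (m j s : ℕ) :
    (m + s).choose (j + 1) = m.choose (j + 1) + ∑ i ∈ range s, (m + i).choose j := by
  induction s with
  | zero => simp
  | succ s ih =>
    rw [sum_range_succ, ← add_assoc, Nat.choose_succ_succ, ih]
    ring

theorem sum_tDeg_s19 {k t : ℕ} {U : Finset ℕ} {F : Finset (Finset ℕ)} (hF : F ⊆ U.powersetCard k) :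
    ∑ S ∈ U.powersetCard t, tDeg F S = #F * k.choose t := by
  simp_rw [tDeg, card_filter]
  rw [sum_comm, ← smul_eq_mul, ← sum_const]
  refine sum_congr rfl fun A hA => ?_
  obtain ⟨hAU, hAk⟩ := mem_powersetCard.1 (hF hA)
  rw [← card_filter, ← hAk, ← card_powersetCard]
  congr 1
  ext S
  simp only [mem_filter, mem_powersetCard]
  exact ⟨fun h => ⟨h.2, h.1.2⟩, fun h => ⟨⟨h.1.trans hAU, h.2⟩, h.1⟩⟩

theorem choose_le_card_of_le_tDeg {n s t l : ℕ} (hst : 3 * (s * t) ≤ l + 1) (hs : 1 ≤ s)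
    (htl : t ≤ l) (hn : s + t ≤ n)
    {F : Finset (Finset ℕ)} (hF : F ⊆ (Icc 1 n).powersetCard (l + 1))
    (hdeg : ∀ S ∈ (Icc 1 n).powersetCard t,
      (n - t).choose (l + 1 - t) - (n - s - t).choose (l + 1 - t) ≤ tDeg F S) :
    3 * n.choose (l + 1) ≤ 3 * #F + 3 * (n - s).choose (l + 1) + (n - 1).choose l := by
  obtain ⟨m, rfl⟩ : ∃ m, n = m + t + s := ⟨n - t - s, by lia⟩
  obtain ⟨j, rfl⟩ : ∃ j, l = t + j := ⟨l - t, by lia⟩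
  have e1 : m + t + s - t = m + s := by lia
  have e2 : m + t + s - s - t = m := by lia
  have e3 : t + j + 1 - t = j + 1 := by lia
  have e4 : m + t + s - s = m + t := by lia
  rw [e1, e2, e3] at hdeg
  rw [e4]
  have h1 := sum_le_sum hdeg
  rw [sum_tDeg_s19 hF, sum_const, card_powersetCard, Nat.card_Icc, smul_eq_mul, choose_add_eq_sum,
    Nat.add_sub_cancel_left, Nat.add_sub_cancel, mul_sum] at h1
  have h2 : (t + j).choose t * ∑ i ∈ range s, (m + t + i).choose (t + j) ≤
      #F * (t + j + 1).choose t := by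
    refine le_trans ?_ h1
    rw [mul_sum]
    refine sum_le_sum fun i hi => ?_
    have h3 := Nat.choose_mul (n := m + t + i) (k := t + j) (s := t) (by lia)
    rw [show m + t + i - t = m + i by lia, show t + j - t = j by lia] at h3
    rw [mul_comm, h3]
    have := mem_range.1 hi
    exact Nat.mul_le_mul_right _ (Nat.choose_le_choose _ (by lia))
  have h4 := choose_add_eq_sum (m + t) (t + j) s
  set S := ∑ i ∈ range s, (m + t + i).choose (t + j) with hS
  have h5 : S ≤ s * (m + t + s - 1).choose (t + j) := by
    refine (sum_le_card_nsmul _ _ _ fun i hi => ?_).trans (by rw [card_range, smul_eq_mul])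
    have := mem_range.1 hi
    exact Nat.choose_le_choose _ (by lia)
  have h6 : (t + j + 1).choose t * (j + 1) = (t + j).choose t * (t + j + 1) := by
    have := Nat.choose_mul_succ_eq (t + j) t
    rw [show t + j + 1 - t = j + 1 by lia] at this
    exact this.symm
  have h7 : (j + 1) * S ≤ (t + j + 1) * #F := by
    refine Nat.le_of_mul_le_mul_left ?_ (Nat.choose_pos (show t ≤ t + j + 1 by lia))
    calc (t + j + 1).choose t * ((j + 1) * S) = (t + j + 1) * ((t + j).choose t * S) := by
          rw [← mul_assoc, h6]; ring
      _ ≤ (t + j + 1) * (#F * (t + j + 1).choose t) := Nat.mul_le_mul_left _ h2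
      _ = (t + j + 1).choose t * ((t + j + 1) * #F) := by ring
  set N := (m + t + s - 1).choose (t + j) with hN
  have h8 : 3 * (t * S) ≤ (t + j + 1) * N := by
    calc 3 * (t * S) ≤ 3 * (t * (s * N)) := by gcongr
      _ = 3 * (s * t) * N := by ring
      _ ≤ (t + j + 1) * N := Nat.mul_le_mul_right _ hst
  have h9 : 3 * S ≤ 3 * #F + N := by
    refine Nat.le_of_mul_le_mul_left ?_ (show 0 < t + j + 1 by lia)
    linarith
  lia

theorem card_filter_superset {k : ℕ} {S W : Finset ℕ} (hSW : S ⊆ W) (hk : #S ≤ k) :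
    #((W.powersetCard k).filter fun A => S ⊆ A) = (#W - #S).choose (k - #S) := by
  rw [← card_sdiff_of_subset hSW, ← card_powersetCard]
  refine card_nbij' (fun A => A \ S) (fun C => C ∪ S) ?_ ?_ ?_ ?_
  · intro A hA
    obtain ⟨hA, hSA⟩ := mem_filter.1 hA
    obtain ⟨hAW, hAk⟩ := mem_powersetCard.1 hA
    exact mem_powersetCard.2 ⟨sdiff_subset_sdiff hAW le_rfl, by
      rw [card_sdiff_of_subset hSA, hAk]⟩
  · intro C hC
    obtain ⟨hCW, hCk⟩ := mem_powersetCard.1 hC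
    refine mem_filter.2 ⟨mem_powersetCard.2 ⟨union_subset (hCW.trans sdiff_subset) hSW, ?_⟩,
      subset_union_right⟩
    rw [card_union_of_disjoint (disjoint_of_subset_left hCW sdiff_disjoint), hCk]
    lia
  · intro A hA
    exact sdiff_union_of_subset (mem_filter.1 hA).2
  · intro C hC
    exact union_sdiff_cancel_right
      (disjoint_of_subset_left (mem_powersetCard.1 hC).1 sdiff_disjoint)

theorem card_filter_superset_not_disjoint {n s k : ℕ} {S T U : Finset ℕ} (hU : #U = n)
    (hTU : T ⊆ U) (hT : #T = s) (hSU : S ⊆ U \ T) (hk : #S ≤ k) :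
    #((U.powersetCard k).filter fun A => S ⊆ A ∧ ¬ Disjoint A T) =
      (n - #S).choose (k - #S) - (n - s - #S).choose (k - #S) := by
  have h1 := card_filter_superset (hSU.trans sdiff_subset) hk
  have h2 := card_filter_superset hSU hk
  rw [card_sdiff_of_subset hTU, hT, hU] at h2
  rw [hU] at h1
  have h3 : ((U \ T).powersetCard k).filter (fun A => S ⊆ A) =
      ((U.powersetCard k).filter fun A => S ⊆ A).filter fun A => Disjoint A T := by
    ext A
    simp only [mem_filter, mem_powersetCard, subset_sdiff]
    tauto
  have h4 := card_filter_add_card_filter_not (s := (U.powersetCard k).filter fun A => S ⊆ A)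
    fun A => Disjoint A T
  rw [← h3, h2, h1, filter_filter] at h4
  lia

theorem exists_perm_image_eq {C D U : Finset ℕ} (hC : C ⊆ U) (hD : D ⊆ U) (h : #C = #D) :
    ∃ σ : Equiv.Perm ℕ, U.image σ = U ∧ C.image σ = D := by
  have hsub : ∀ {E : Finset ℕ}, E ⊆ U → #(E.subtype (· ∈ U)) = #E := fun {E} hE => by
    rw [card_subtype, filter_true_of_mem hE]
  obtain ⟨τ, hτ⟩ := exists_perm_map_eq (α := U) (C := C.subtype (· ∈ U))
    (D := D.subtype (· ∈ U)) (by rw [hsub hC, hsub hD, h])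
  refine ⟨Equiv.Perm.ofSubtype τ, ?_, ?_⟩
  · refine eq_of_subset_of_card_le (fun y hy => ?_)
      (card_image_of_injective _ (Equiv.injective _)).ge
    obtain ⟨x, hx, rfl⟩ := mem_image.1 hy
    rw [Equiv.Perm.ofSubtype_apply_of_mem τ hx]
    exact (τ ⟨x, hx⟩).2
  · refine eq_of_subset_of_card_le (fun y hy => ?_)
      ((card_image_of_injective _ (Equiv.injective _)).trans h).ge
    obtain ⟨x, hx, rfl⟩ := mem_image.1 hy
    rw [Equiv.Perm.ofSubtype_apply_of_mem τ (hC hx)]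
    have : τ ⟨x, hC hx⟩ ∈ D.subtype (· ∈ U) := by
      rw [← hτ]
      exact mem_map_of_mem _ (by simpa using hx)
    simpa using this

theorem isomorphicFam_A0fam {n s k : ℕ} {T : Finset ℕ} (hTU : T ⊆ Icc 1 n) (hT : #T = s) :
    IsomorphicFam n (((Icc 1 n).powersetCard k).filter fun A => ¬ Disjoint A T)
      (A0fam n k s) := by
  have hsn : s ≤ n := by simpa [hT] using card_le_card hTU
  obtain ⟨σ, hσU, hσT⟩ := exists_perm_image_eq hTU (Icc_subset_Icc (le_refl 1) hsn)
    (by simpa using hT)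
  refine ⟨σ, hσU, ?_⟩
  have hmem : ∀ A : Finset ℕ, A.image σ ∈ A0fam n k s ↔
      A ∈ ((Icc 1 n).powersetCard k).filter fun A => ¬ Disjoint A T := by
    intro A
    rw [A0fam, mem_filter, mem_filter, mem_powersetCard, mem_powersetCard,
      card_image_of_injective _ σ.injective, ← not_disjoint_iff_nonempty_inter]
    nth_rewrite 1 [← hσU]
    rw [← hσT, image_subset_image_iff σ.injective, disjoint_image σ.injective]
  ext B
  rw [mem_image]
  constructor
  · rintro ⟨A, hA, rfl⟩
    exact (hmem A).2 hA
  · intro hB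
    have h1 : (B.image σ.symm).image σ = B := by simp [image_image]
    exact ⟨B.image σ.symm, (hmem _).1 (h1.symm ▸ hB), h1⟩

theorem noRainbow_of_matching_le {s k : ℕ} (hk : 1 ≤ k) {U : Finset ℕ} {F : Finset (Finset ℕ)}
    (hF : F ⊆ U.powersetCard k)
    (hmatch : ∀ G ⊆ F, (∀ A ∈ G, ∀ B ∈ G, A ≠ B → A ∩ B = ∅) → G.card ≤ s) :
    NoRainbow fun _ : Fin (s + 1) => F := by
  intro D hD hd
  have hinj : Function.Injective D := by
    intro i j hij
    by_contra hne
    have h1 := hd hne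
    simp only [Function.onFun, hij, disjoint_self_iff_empty] at h1
    have h2 := (mem_powersetCard.1 (hF (hD j))).2
    rw [h1, card_empty] at h2
    lia
  have h1 := hmatch (univ.image D) (image_subset_iff.2 fun i _ => hD i) ?_
  · rw [card_image_of_injective _ hinj, card_univ, Fintype.card_fin] at h1
    lia
  · intro A hA B hB hne
    obtain ⟨i, _, rfl⟩ := mem_image.1 hA
    obtain ⟨j, _, rfl⟩ := mem_image.1 hB
    exact disjoint_iff_inter_eq_empty.1 (hd fun h => hne (by rw [h]))

theorem exists_cover_of_le_tDeg {n s t l : ℕ} (hs : 1 ≤ s) (ht : 1 ≤ t)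
    (hst : 3 * (s * t) ≤ l + 1) (hn : 2 * (l + 1) ^ 2 ≤ n) {F : Finset (Finset ℕ)}
    (hF : F ⊆ (Icc 1 n).powersetCard (l + 1)) (hR : NoRainbow fun _ : Fin (s + 1) => F)
    (hdeg : ∀ S ∈ (Icc 1 n).powersetCard t,
      (n - t).choose (l + 1 - t) - (n - s - t).choose (l + 1 - t) ≤ tDeg F S) :
    ∃ T ⊆ Icc 1 n, #T = s ∧ ∀ A ∈ F, ¬ Disjoint A T := by
  have h1 : s ≤ s * t := Nat.le_mul_of_pos_right _ ht
  have h2 : t ≤ s * t := Nat.le_mul_of_pos_left _ hs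
  refine (hR.cover_or_card_le hs (by lia) hn hF).resolve_right fun h => ?_
  have h3 := choose_le_card_of_le_tDeg hst hs (by lia) (by nlinarith) hF hdeg
  have h4 := choose_lt_two_mul_choose (show 3 * s ≤ l + 1 by lia) hn
  lia

/-- the degree version of the Erdős Matching Conjecture
(Theorem `degEKR`). -/
theorem statement19 (n s k t : ℕ) (hs : 1 ≤ s) (ht : 1 ≤ t) (hk : 1 ≤ k)
    (hn : 2 * k ^ 2 ≤ n)
    (hkst : 5 * s * t ≤ k ∨ (t = 1 ∧ 3 * s ≤ k))
    (F : Finset (Finset ℕ)) (hF : F ⊆ (Finset.Icc 1 n).powersetCard k)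
    (hmatch : ∀ G ⊆ F, (∀ A ∈ G, ∀ B ∈ G, A ≠ B → A ∩ B = ∅) → G.card ≤ s) :
    (∃ S ∈ (Finset.Icc 1 n).powersetCard t,
      tDeg F S ≤ Nat.choose (n - t) (k - t) - Nat.choose (n - s - t) (k - t)) ∧
    ((∀ S ∈ (Finset.Icc 1 n).powersetCard t,
        Nat.choose (n - t) (k - t) - Nat.choose (n - s - t) (k - t) ≤ tDeg F S) →
      IsomorphicFam n F (A0fam n k s)) := by
  have hR := noRainbow_of_matching_le hk hF hmatch
  obtain ⟨l, rfl⟩ := Nat.exists_eq_add_of_le' hk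
  have hst : 3 * (s * t) ≤ l + 1 := by
    rcases hkst with h | ⟨rfl, h⟩
    · rw [mul_assoc] at h
      lia
    · lia
  have hs' : s ≤ s * t := Nat.le_mul_of_pos_right _ ht
  have ht' : t ≤ s * t := Nat.le_mul_of_pos_left _ hs
  have hcard : ∀ T ⊆ Icc 1 n, #T = s → ∀ S ⊆ Icc 1 n \ T, #S = t →
      #(((Icc 1 n).powersetCard (l + 1)).filter fun A => S ⊆ A ∧ ¬ Disjoint A T) =
        (n - t).choose (l + 1 - t) - (n - s - t).choose (l + 1 - t) := by
    intro T hTU hT S hS hSt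
    rw [← hSt]
    exact card_filter_superset_not_disjoint (by simp) hTU hT hS (by lia)
  have hsub : ∀ T, (∀ A ∈ F, ¬ Disjoint A T) → ∀ S, F.filter (fun A => S ⊆ A) ⊆
      ((Icc 1 n).powersetCard (l + 1)).filter fun A => S ⊆ A ∧ ¬ Disjoint A T := by
    intro T hcov S A hA
    obtain ⟨hA, hSA⟩ := mem_filter.1 hA
    exact mem_filter.2 ⟨hF hA, hSA, hcov A hA⟩
  have hstn : s + t ≤ n := by nlinarith
  constructor
  · by_contra! hcon
    obtain ⟨T, hTU, hT, hcov⟩ := exists_cover_of_le_tDeg hs ht hst hn hF hR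
      fun S hS => (hcon S hS).le
    obtain ⟨S, hS, hSt⟩ := exists_subset_card_eq (s := Icc 1 n \ T) (n := t) (by
      rw [card_sdiff_of_subset hTU, hT, Nat.card_Icc]
      lia)
    refine (hcon S (mem_powersetCard.2 ⟨hS.trans sdiff_subset, hSt⟩)).not_ge ?_
    rw [← hcard T hTU hT S hS hSt]
    exact card_le_card (hsub T hcov S)
  · intro hdeg
    obtain ⟨T, hTU, hT, hcov⟩ := exists_cover_of_le_tDeg hs ht hst hn hF hR hdeg
    have hFT : F = ((Icc 1 n).powersetCard (l + 1)).filter fun A => ¬ Disjoint A T := by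
      refine Subset.antisymm (fun A hA => mem_filter.2 ⟨hF hA, hcov A hA⟩) fun A hA => ?_
      obtain ⟨hAk, hAT⟩ := mem_filter.1 hA
      obtain ⟨hAU, hAc⟩ := mem_powersetCard.1 hAk
      obtain ⟨S, hS, hSt⟩ := exists_subset_card_eq (s := A \ T) (n := t) (by
        have := le_card_sdiff T A
        lia)
      have hSU : S ⊆ Icc 1 n \ T := hS.trans (sdiff_subset_sdiff hAU le_rfl)
      have h1 := hdeg S (mem_powersetCard.2 ⟨hSU.trans sdiff_subset, hSt⟩)
      rw [← hcard T hTU hT S hSU hSt] at h1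
      have h2 := eq_of_subset_of_card_le (hsub T hcov S) h1
      have h3 : A ∈ F.filter fun A => S ⊆ A := by
        rw [h2]
        exact mem_filter.2 ⟨hAk, hS.trans sdiff_subset, hAT⟩
      exact (mem_filter.1 h3).1
    rw [hFT]
    exact isomorphicFam_A0fam hTU hT
end
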